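/- arXiv:2503.00827 — 2 statements merged into one kernel-verified Lean document; each statement's English description precedes it below -/
import Mathlib

section
/- For every M ≥ 2 and α_0 > 0, if k = 5 there exist constants c_0 > 0, b > 0 and 0 < δ < 1/k such that, for Λ̃ = Λ(e_1), the multiscale sequence {σ_n}_{n≥0} (with parameters λ_n = α_0 M^n, fidelity exponent α = 2 and regularization exponent β = 1) coincides with the explicit sequence σ_n = Σ_{j=0}^n u_j where u_j = (b/√(j+2)) e_{j+2}; in particular ‖σ_n‖_{ℓ²} → +∞. -/
open Filter Finset
open scoped ENNReal Topology

noncomputable section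

def Acoef (k : ℕ) (δ : ℝ) (i : ℕ) : ℝ :=
  if i = 1 then 1 - k * δ else if i = k then 2 * δ else δ

def Ccoef (k : ℕ) (δ : ℝ) (m : ℕ) : ℝ := ∑ i ∈ Finset.Icc 1 m, Acoef k δ i

def eta (c0 M : ℝ) (j : ℕ) : ℝ := Real.sqrt (c0 / M ^ j)

def mu (c0 M δ : ℝ) (j : ℕ) : ℝ := -δ * eta c0 M j

/-- The `m`-th coordinate (paper indices) of `Λ e_j` for the second counterexample:
for `j ≥ 2`,
`Λ e_j = (√j/b)[ ∑_{i=1}^k A_i η_{j+i−2} e_{j+i−2} + μ_{j+k−2} e_{j+k−2} − μ_{j+k−1} e_{j+k−1} ]`,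
and `Λ e₁ = ∑_{m=1}^k C_m η_m e_m + ∑_{m≥k+1} η_m e_m + μ_k e_k`. -/
def lamCoord2 (c0 M δ b : ℝ) (k j m : ℕ) : ℝ :=
  if j = 1 then
    (if 1 ≤ m ∧ m ≤ k then Ccoef k δ m * eta c0 M m
      else if k + 1 ≤ m then eta c0 M m else 0) +
      (if m = k then mu c0 M δ k else 0)
  else
    (Real.sqrt j / b) *
      ((if j - 1 ≤ m ∧ m ≤ j + k - 2 then Acoef k δ (m + 2 - j) * eta c0 M m else 0) +
        (if m = j + k - 2 then mu c0 M δ m else 0) -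
        (if m = j + k - 1 then mu c0 M δ m else 0))

def lpSpec2 (c0 M δ b : ℝ) (k : ℕ)
    (Λ : lp (fun _ : ℕ => ℝ) 2 →L[ℝ] lp (fun _ : ℕ => ℝ) 2) : Prop :=
  ∀ j m : ℕ, (Λ (lp.single 2 j 1)) m = lamCoord2 c0 M δ b k (j + 1) (m + 1)

/-- The Banach norm regularization `R(γ) = ‖γ‖_{F₂} = ∑_{n≥1} √n |γ_n|` (paper indices),
with value `+∞` when `γ ∉ F₂`. -/
def Rl2 (γ : lp (fun _ : ℕ => ℝ) 2) : ℝ≥0∞ :=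
  ∑' n : ℕ, ENNReal.ofReal (Real.sqrt ((n : ℝ) + 1) * |γ n|)

/-- `u_j = (b/√(j+2)) e_{j+2}`. -/
def useq2 (b : ℝ) (j : ℕ) : lp (fun _ : ℕ => ℝ) 2 :=
  (b / Real.sqrt ((j : ℝ) + 2)) • lp.single 2 (j + 1) 1

/-- The functional of the `n`-th step of the multiscale procedure. -/
def Jfun2 (α0 M b : ℝ) (Λ : lp (fun _ : ℕ => ℝ) 2 →L[ℝ] lp (fun _ : ℕ => ℝ) 2)
    (n : ℕ) (v : lp (fun _ : ℕ => ℝ) 2) : ℝ≥0∞ :=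
  ENNReal.ofReal (α0 * M ^ n *
      ‖Λ (lp.single 2 0 1) - Λ ((∑ j ∈ Finset.range n, useq2 b j) + v)‖ ^ 2) +
    Rl2 v

/-- The `m`-th weight of the residual, counted from the last coordinate already cancelled. -/
def residualWeight (m : ℕ) : ℝ :=
  if m = 0 then 0 else if m ≤ 5 then 1 / 10 + 9 / 50 * ((m : ℝ) - 1) else 1

/-- The normalised weight of `Λ e_{q+2}` in the coordinate of index `p` (counted from `0`). -/
def columnWeight (q p : ℕ) : ℝ :=
  if p = q then 1 / 10 else if q < p ∧ p ≤ q + 5 then 9 / 50 else 0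

lemma lamCoord2_one (c0 M b : ℝ) (p : ℕ) :
    lamCoord2 c0 M (9 / 50) b 5 1 (p + 1) = residualWeight (p + 1) * eta c0 M (p + 1) := by
  by_cases hp : p < 5
  · interval_cases p <;>
      norm_num [lamCoord2, Ccoef, Acoef, residualWeight, mu, Finset.sum_Icc_succ_top]
    ring
  · have h1 : ¬ (p + 1 ≤ 5) := by omega
    have h2 : 6 ≤ p + 1 := by omega
    have h3 : p + 1 ≠ 5 := by omega
    simp only [lamCoord2, residualWeight, h1, h2, h3]
    simp

lemma lamCoord2_add_two (c0 M b : ℝ) (q p : ℕ) :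
    lamCoord2 c0 M (9 / 50) b 5 (q + 2) (p + 1) =
      Real.sqrt ((q : ℝ) + 2) / b * (columnWeight q p * eta c0 M (p + 1)) := by
  by_cases h : q ≤ p ∧ p ≤ q + 5
  · obtain ⟨i, rfl⟩ := Nat.exists_eq_add_of_le h.1
    have hi : i ≤ 5 := by omega
    have e : q + i + 1 + 2 - (q + 2) = i + 1 := by omega
    have h1 : q + 2 ≠ 1 := by omega
    have h2 : q + 2 - 1 ≤ q + i + 1 ∧ q + i + 1 ≤ q + 2 + 5 - 2 ↔ i < 5 := by omega
    have h3 : q + i + 1 = q + 2 + 5 - 2 ↔ i = 4 := by omega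
    have h4 : q + i + 1 = q + 2 + 5 - 1 ↔ i = 5 := by omega
    simp only [lamCoord2, e, h1, h2, h3, h4]
    interval_cases i <;> norm_num [columnWeight, Acoef, mu]
    exact Or.inl (by ring)
  · have h1 : ¬ (q + 2 - 1 ≤ p + 1 ∧ p + 1 ≤ q + 2 + 5 - 2) := by omega
    have h2 : p + 1 ≠ q + 2 + 5 - 2 := by omega
    have h3 : p + 1 ≠ q + 2 + 5 - 1 := by omega
    have h4 : p ≠ q := by omega
    have h5 : ¬ (q < p ∧ p ≤ q + 5) := by omega
    simp only [lamCoord2, columnWeight, h1, h2, h3, h4, h5]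
    simp

lemma residualWeight_sub_columnWeight (n p : ℕ) :
    residualWeight (p + 1 - n) - columnWeight n p = residualWeight (p - n) := by
  by_cases h : n ≤ p
  · obtain ⟨i, rfl⟩ := Nat.exists_eq_add_of_le h
    have e : n + i + 1 - n = i + 1 := by omega
    have e' : n + i - n = i := by omega
    rw [e, e']
    by_cases hi : i ≤ 5
    · interval_cases i <;> norm_num [columnWeight, residualWeight]
    · have h1 : ¬ (i + 1 ≤ 5) := by omega
      have h2 : i ≠ 0 := by omega
      simp [columnWeight, residualWeight, h1, h2, hi]
  · have e : p + 1 - n = 0 := by omega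
    have e' : p - n = 0 := by omega
    have h1 : p ≠ n := by omega
    have h2 : ¬ n < p := by omega
    simp [columnWeight, residualWeight, e, e', h1, h2]

lemma residualWeight_nonneg (m : ℕ) : 0 ≤ residualWeight m := by
  unfold residualWeight
  split_ifs with h h'
  · exact le_rfl
  · have : (1 : ℝ) ≤ m := by exact_mod_cast Nat.one_le_iff_ne_zero.mpr h
    linarith
  · exact zero_le_one

lemma residualWeight_le_one (m : ℕ) : residualWeight m ≤ 1 := by
  unfold residualWeight
  split_ifs with h h'
  · exact zero_le_one
  · have : (m : ℝ) ≤ 5 := by exact_mod_cast h'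
    linarith
  · exact le_rfl

/-- The correlation of the residual with the `q`-th column, up to normalisation, when the first
`n + 1` coordinates of the residual vanish. -/
def correlation (x : ℝ) (n q : ℕ) : ℝ :=
  1 / 10 * residualWeight (q - n) +
    9 / 50 * ∑ i ∈ Finset.Icc 1 5, x ^ i * residualWeight (q + i - n)

lemma correlation_nonneg {x : ℝ} (hx : 0 ≤ x) (n q : ℕ) : 0 ≤ correlation x n q := by
  have h := residualWeight_nonneg
  have : 0 ≤ ∑ i ∈ Finset.Icc 1 5, x ^ i * residualWeight (q + i - n) :=
    Finset.sum_nonneg fun i _ => mul_nonneg (pow_nonneg hx i) (h _)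
  have := h (q - n)
  unfold correlation
  positivity

lemma correlation_self (x : ℝ) (n : ℕ) : correlation x n n = correlation x 0 0 := by
  simp [correlation]

lemma correlation_zero_zero (x : ℝ) : correlation x 0 0 =
    9 / 50 * (1 / 10 * x + 7 / 25 * x ^ 2 + 23 / 50 * x ^ 3 + 16 / 25 * x ^ 4 +
      41 / 50 * x ^ 5) := by
  norm_num [correlation, residualWeight, Finset.sum_Icc_succ_top]
  ring

lemma correlation_zero_zero_pos {x : ℝ} (hx : 0 < x) : 0 < correlation x 0 0 := by
  rw [correlation_zero_zero]
  positivity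

lemma pow_mul_correlation_lt {x : ℝ} (hx : 0 < x) (hx2 : x ≤ 1 / 2) (n l : ℕ) (hl : 1 ≤ l) :
    x ^ l * correlation x n (n + l) < correlation x 0 0 := by
  have e : correlation x n (n + l) = correlation x 0 l := by
    have h (i : ℕ) : n + l + i - n = l + i := by omega
    simp [correlation, h]
  rw [e, correlation_zero_zero]
  have p1 : 0 < x ^ 2 := by positivity
  have q1 : x ^ 2 ≤ 1 / 2 * x := by nlinarith
  have q2 : x ^ 3 ≤ 1 / 2 * x ^ 2 := by nlinarith
  have q3 : x ^ 4 ≤ 1 / 2 * x ^ 3 := by nlinarith [pow_pos hx 3]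
  have q4 : x ^ 5 ≤ 1 / 2 * x ^ 4 := by nlinarith [pow_pos hx 4]
  have q5 : x ^ 6 ≤ 1 / 2 * x ^ 5 := by nlinarith [pow_pos hx 5]
  have q6 : x ^ 7 ≤ 1 / 2 * x ^ 6 := by nlinarith [pow_pos hx 6]
  have q7 : x ^ 8 ≤ 1 / 2 * x ^ 7 := by nlinarith [pow_pos hx 7]
  have q8 : x ^ 9 ≤ 1 / 2 * x ^ 8 := by nlinarith [pow_pos hx 8]
  have q9 : x ^ 10 ≤ 1 / 2 * x ^ 9 := by nlinarith [pow_pos hx 9]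
  by_cases h5 : l ≤ 5
  · interval_cases l <;>
      norm_num [correlation, residualWeight, Finset.sum_Icc_succ_top] <;> ring_nf <;>
      linarith [pow_pos hx 10]
  · have hc : correlation x 0 l ≤ 7 / 25 := by
      have hs : ∑ i ∈ Finset.Icc 1 5, x ^ i * residualWeight (l + i - 0) ≤
          ∑ i ∈ Finset.Icc 1 5, x ^ i :=
        Finset.sum_le_sum fun i _ =>
          mul_le_of_le_one_right (pow_nonneg hx.le i) (residualWeight_le_one _)
      have hg : ∑ i ∈ Finset.Icc 1 5, x ^ i ≤ 1 := by
        norm_num [Finset.sum_Icc_succ_top]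
        linarith
      have := residualWeight_le_one (l - 0)
      unfold correlation
      linarith
    have hp : x ^ l ≤ x ^ 6 := pow_le_pow_of_le_one hx.le (by linarith) (by omega)
    have : x ^ l * correlation x 0 l ≤ x ^ 6 * (7 / 25) :=
      mul_le_mul hp hc (correlation_nonneg hx.le _ _) (by positivity)
    linarith [pow_pos hx 6]

lemma correlation_lt_pow_mul {x : ℝ} (hx : 0 < x) (q l : ℕ) (hl : 1 ≤ l) :
    correlation x (q + l) q < x ^ l * correlation x 0 0 := by
  have e : q - (q + l) = 0 := by omega
  have e' (i : ℕ) : q + i - (q + l) = i - l := by omega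
  simp only [correlation, e, e']
  have := pow_pos hx
  by_cases h5 : l < 5
  · interval_cases l <;>
      norm_num [residualWeight, Finset.sum_Icc_succ_top] <;> ring_nf <;>
      linarith [this 4, this 5, this 6, this 7, this 8, this 9, this 2, this 3]
  · have h0 : ∑ i ∈ Finset.Icc 1 5, x ^ i * residualWeight (i - l) = 0 := by
      refine Finset.sum_eq_zero fun i hi => ?_
      have : i - l = 0 := by have := (Finset.mem_Icc.mp hi).2; omega
      simp [this, residualWeight]
    have hr : residualWeight 0 = 0 := by simp [residualWeight]
    rw [h0, hr]
    have := mul_pos (pow_pos hx l) (correlation_zero_zero_pos hx)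
    simpa [correlation, hr] using this

/-- If the residual `r` left by a one-atom candidate `c • e_s` satisfies the strict first-order
conditions, then the candidate is the unique minimiser. -/
lemma single_isStrictMin {E : Type*} [NormedAddCommGroup E] [InnerProductSpace ℝ E]
    (Λ : lp (fun _ : ℕ => ℝ) 2 →L[ℝ] E) (r : E) {c a : ℝ} (hc : 0 < c) (ha : 0 < a) (s : ℕ)
    (hs : 2 * a * inner ℝ r (Λ (lp.single 2 s 1)) = Real.sqrt ((s : ℝ) + 1))
    (hne : ∀ j, j ≠ s →
      |2 * a * inner ℝ r (Λ (lp.single 2 j 1))| < Real.sqrt ((j : ℝ) + 1))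
    (hΛ : Λ (lp.single 2 s 1) ≠ 0) (v : lp (fun _ : ℕ => ℝ) 2) :
    ENNReal.ofReal (a * ‖r‖ ^ 2) + Rl2 (c • lp.single 2 s 1) ≤
        ENNReal.ofReal (a * ‖r - Λ (v - c • lp.single 2 s 1)‖ ^ 2) + Rl2 v ∧
      (ENNReal.ofReal (a * ‖r - Λ (v - c • lp.single 2 s 1)‖ ^ 2) + Rl2 v ≤
        ENNReal.ofReal (a * ‖r‖ ^ 2) + Rl2 (c • lp.single 2 s 1) →
          v = c • lp.single 2 s 1) := by
  set u : lp (fun _ : ℕ => ℝ) 2 := c • lp.single 2 s 1 with hu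
  have hRu : Rl2 u = ENNReal.ofReal (Real.sqrt ((s : ℝ) + 1) * c) := by
    unfold Rl2
    rw [tsum_eq_single s]
    · simp [hu, abs_of_pos hc]
    · intro j hj
      simp [hu, hj]
  have hun : ENNReal.ofReal (a * ‖r‖ ^ 2) + Rl2 u ≠ ⊤ := by
    rw [hRu]
    exact ENNReal.add_ne_top.mpr ⟨ENNReal.ofReal_ne_top, ENNReal.ofReal_ne_top⟩
  by_cases hv : Rl2 v = ⊤
  · rw [hv, add_top]
    exact ⟨le_top, fun h => absurd (top_le_iff.mp h) hun⟩
  set G : ℕ → ℝ := fun j => 2 * a * inner ℝ r (Λ (lp.single 2 j 1)) with hG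
  set f : ℕ → ℝ := fun j => Real.sqrt ((j : ℝ) + 1) * |v j| with hf
  have hf0 : ∀ j, 0 ≤ f j := fun j => by positivity
  have hfs : Summable f := by
    have := ENNReal.summable_toReal hv
    simpa [ENNReal.toReal_ofReal (hf0 _)] using this
  have hRv : Rl2 v = ENNReal.ofReal (∑' j, f j) :=
    (ENNReal.ofReal_tsum_of_nonneg hf0 hfs).symm
  have hGs : HasSum (fun j => v j * G j) (2 * a * inner ℝ r (Λ v)) := by
    have h := ((lp.hasSum_single (p := 2) (by norm_num) v).mapL
      ((innerSL ℝ r).comp Λ)).mul_left (2 * a)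
    refine (funext fun j => ?_ : (fun j => v j * G j) = _) ▸ h
    have : lp.single 2 j (v j) = v j • (lp.single 2 j 1 : lp (fun _ : ℕ => ℝ) 2) := by
      rw [← lp.single_smul]; simp
    rw [this]
    simp [hG]
    ring
  have hGle : ∀ j, |G j| ≤ Real.sqrt ((j : ℝ) + 1) := fun j => by
    by_cases hj : j = s
    · subst hj
      simp only [hG]
      rw [hs, abs_of_nonneg (Real.sqrt_nonneg _)]
    · exact (hne j hj).le
  have hgap : ∀ j, 0 ≤ f j - v j * G j := fun j => by
    have h1 : v j * G j ≤ |v j| * |G j| := by rw [← abs_mul]; exact le_abs_self _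
    have h2 := mul_le_mul_of_nonneg_left (hGle j) (abs_nonneg (v j))
    simp only [hf]
    linarith
  have hgs := hfs.hasSum.sub hGs
  have hD0 : 0 ≤ ∑' j, f j - 2 * a * inner ℝ r (Λ v) := hgs.nonneg hgap
  have hexp : a * ‖r - Λ (v - u)‖ ^ 2 + ∑' j, f j =
      a * ‖r‖ ^ 2 + Real.sqrt ((s : ℝ) + 1) * c +
        (a * ‖Λ (v - u)‖ ^ 2 + (∑' j, f j - 2 * a * inner ℝ r (Λ v))) := by
    have hru : inner ℝ r (Λ u) = c * inner ℝ r (Λ (lp.single 2 s 1)) := by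
      rw [hu, map_smul, inner_smul_right]
    have h2 : inner ℝ r (Λ (v - u)) = inner ℝ r (Λ v) - inner ℝ r (Λ u) := by
      rw [map_sub, inner_sub_right]
    rw [norm_sub_sq_real, h2, hru, ← hs]
    ring
  have hF0 : 0 ≤ ∑' j, f j := tsum_nonneg hf0
  rw [hRu, hRv, ← ENNReal.ofReal_add (by positivity) (by positivity),
    ← ENNReal.ofReal_add (by positivity) hF0, hexp]
  have hq : 0 ≤ a * ‖Λ (v - u)‖ ^ 2 := by positivity
  refine ⟨ENNReal.ofReal_le_ofReal (by linarith), fun h => ?_⟩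
  rw [ENNReal.ofReal_le_ofReal_iff (by positivity)] at h
  have hΛ0 : a * ‖Λ (v - u)‖ ^ 2 = 0 := by linarith
  have hsum0 : ∑' j, f j - 2 * a * inner ℝ r (Λ v) = 0 := by linarith
  rw [hsum0] at hgs
  have hzero := (hasSum_zero_iff_of_nonneg hgap).mp hgs
  have hvj : ∀ j, j ≠ s → v j = 0 := fun j hj => by
    by_contra hvj
    have h0 : f j - v j * G j = 0 := congrFun hzero j
    have h1 : v j * G j ≤ |v j| * |G j| := by rw [← abs_mul]; exact le_abs_self _
    have h2 := mul_lt_mul_of_pos_left (hne j hj) (abs_pos.mpr hvj)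
    simp only [hf] at h0
    linarith
  have hw : v - u = (v s - c) • (lp.single 2 s 1 : lp (fun _ : ℕ => ℝ) 2) := by
    ext j
    change v j - c * (lp.single 2 s 1 : lp (fun _ : ℕ => ℝ) 2) j =
      (v s - c) * (lp.single 2 s 1 : lp (fun _ : ℕ => ℝ) 2) j
    by_cases hj : j = s
    · subst hj
      simp
    · simp [hvj j hj, hj]
  have hΛw : Λ (v - u) = 0 := by
    simpa [ha.ne'] using hΛ0
  rw [hw, map_smul, smul_eq_zero] at hΛw
  have hvs : v s - c = 0 := hΛw.resolve_right hΛ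
  rw [hvs, zero_smul] at hw
  exact sub_eq_zero.mp hw

lemma norm_sq_sum_useq2 (b : ℝ) (n : ℕ) :
    ‖∑ j ∈ Finset.range n, useq2 b j‖ ^ 2 = ∑ j ∈ Finset.range n, b ^ 2 / ((j : ℝ) + 2) := by
  induction n with
  | zero => simp
  | succ n ih =>
    have ho : inner ℝ (∑ j ∈ Finset.range n, useq2 b j) (useq2 b n) = 0 := by
      rw [sum_inner]
      refine Finset.sum_eq_zero fun j hj => ?_
      have : n ≠ j := (Finset.mem_range.mp hj).ne'
      simp [useq2, inner_smul_left, inner_smul_right, lp.inner_single_left, this]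
    rw [Finset.sum_range_succ, Finset.sum_range_succ, norm_add_sq_real, ho, ih]
    have : ‖useq2 b n‖ ^ 2 = b ^ 2 / ((n : ℝ) + 2) := by
      rw [useq2, norm_smul, lp.norm_single (by norm_num), mul_pow]
      simp [div_pow, Real.sq_sqrt (show (0 : ℝ) ≤ (n : ℝ) + 2 by positivity)]
    rw [this]
    ring

lemma tendsto_norm_sum_useq2 {b : ℝ} (hb : 0 < b) :
    Tendsto (fun n : ℕ => ‖∑ j ∈ Finset.range (n + 1), useq2 b j‖) atTop atTop := by
  have h : Tendsto (fun n : ℕ => ∑ j ∈ Finset.range n, b ^ 2 / ((j : ℝ) + 2)) atTop atTop := by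
    refine not_summable_iff_tendsto_nat_atTop_of_nonneg (fun j => by positivity) |>.mp ?_
    intro hs
    have h1 : Summable fun j : ℕ => 1 / ((j : ℝ) + 2) := by
      have := hs.mul_left (1 / b ^ 2)
      refine this.congr fun j => ?_
      field_simp
    refine Real.not_summable_one_div_natCast ((summable_nat_add_iff 2).mp ?_)
    simpa using h1
  refine tendsto_atTop_mono (fun n => ?_)
    (Real.tendsto_sqrt_atTop.comp (h.comp (tendsto_add_atTop_nat 1)))
  simp only [Function.comp]
  rw [← norm_sq_sum_useq2, Real.sqrt_sq (norm_nonneg _)]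

lemma eta_mul_self {c0 M : ℝ} (hc0 : 0 ≤ c0) (hM : 0 ≤ M) (j : ℕ) :
    eta c0 M j * eta c0 M j = c0 * M⁻¹ ^ j := by
  rw [eta, Real.mul_self_sqrt (by positivity), inv_pow, div_eq_mul_inv]

section Spec

variable {c0 M b : ℝ} {Λ : lp (fun _ : ℕ => ℝ) 2 →L[ℝ] lp (fun _ : ℕ => ℝ) 2}

lemma lpSpec2.apply_zero (hΛ : lpSpec2 c0 M (9 / 50) b 5 Λ) (p : ℕ) :
    (Λ (lp.single 2 0 1)) p = residualWeight (p + 1) * eta c0 M (p + 1) := by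
  rw [hΛ, zero_add, lamCoord2_one]

lemma lpSpec2.apply_succ (hΛ : lpSpec2 c0 M (9 / 50) b 5 Λ) (q p : ℕ) :
    (Λ (lp.single 2 (q + 1) 1)) p =
      Real.sqrt ((q : ℝ) + 2) / b * (columnWeight q p * eta c0 M (p + 1)) := by
  rw [hΛ, lamCoord2_add_two]

lemma lpSpec2.apply_useq2 (hΛ : lpSpec2 c0 M (9 / 50) b 5 Λ) (hb : 0 < b) (n p : ℕ) :
    (Λ (useq2 b n)) p = columnWeight n p * eta c0 M (p + 1) := by
  rw [useq2, map_smul]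
  change b / Real.sqrt ((n : ℝ) + 2) * (Λ (lp.single 2 (n + 1) 1)) p = _
  rw [hΛ.apply_succ]
  have : 0 < Real.sqrt ((n : ℝ) + 2) := Real.sqrt_pos.mpr (by positivity)
  field_simp

lemma lpSpec2.residual_apply (hΛ : lpSpec2 c0 M (9 / 50) b 5 Λ) (hb : 0 < b) (n p : ℕ) :
    (Λ (lp.single 2 0 1) - Λ (∑ j ∈ Finset.range n, useq2 b j)) p =
      residualWeight (p + 1 - n) * eta c0 M (p + 1) := by
  induction n with
  | zero => simpa using hΛ.apply_zero p
  | succ n ih =>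
    rw [Finset.sum_range_succ, map_add, ← sub_sub]
    change (Λ (lp.single 2 0 1) - Λ (∑ j ∈ Finset.range n, useq2 b j)) p - Λ (useq2 b n) p = _
    rw [ih, hΛ.apply_useq2 hb, ← sub_mul, residualWeight_sub_columnWeight,
      Nat.add_sub_add_right]

lemma lpSpec2.inner_apply_succ (hΛ : lpSpec2 c0 M (9 / 50) b 5 Λ) (hc0 : 0 ≤ c0) (hM : 0 ≤ M)
    {r : lp (fun _ : ℕ => ℝ) 2} {n : ℕ}
    (hr : ∀ p, r p = residualWeight (p - n) * eta c0 M (p + 1)) (q : ℕ) :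
    inner ℝ r (Λ (lp.single 2 (q + 1) 1)) =
      Real.sqrt ((q : ℝ) + 2) / b * (c0 * M⁻¹ ^ (q + 1) * correlation M⁻¹ n q) := by
  have hterm (p : ℕ) : inner ℝ (r p) ((Λ (lp.single 2 (q + 1) 1)) p) =
      Real.sqrt ((q : ℝ) + 2) / b *
        (columnWeight q p * residualWeight (p - n) * (c0 * M⁻¹ ^ (p + 1))) := by
    rw [hΛ.apply_succ, hr, ← eta_mul_self hc0 hM]
    simp only [RCLike.inner_apply, conj_trivial]
    ring
  rw [lp.inner_eq_tsum]
  simp_rw [hterm]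
  rw [tsum_eq_sum (s := Finset.Ico q (q + 6)), Finset.sum_Ico_eq_sum_range, ← Finset.mul_sum]
  · rw [Nat.add_sub_cancel_left]
    norm_num [Finset.sum_range_succ, columnWeight, correlation, Finset.sum_Icc_succ_top]
    left
    ring
  · intro p hp
    rw [Finset.mem_Ico] at hp
    have h1 : p ≠ q := by omega
    have h2 : ¬ (q < p ∧ p ≤ q + 5) := by omega
    simp [columnWeight, h1, h2]

lemma lpSpec2.inner_apply_zero (hΛ : lpSpec2 c0 M (9 / 50) b 5 Λ) (hc0 : 0 ≤ c0) (hM : 2 ≤ M)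
    {r : lp (fun _ : ℕ => ℝ) 2} {n : ℕ}
    (hr : ∀ p, r p = residualWeight (p - n) * eta c0 M (p + 1)) :
    0 ≤ inner ℝ r (Λ (lp.single 2 0 1)) ∧
      M ^ n * inner ℝ r (Λ (lp.single 2 0 1)) ≤ c0 / 2 := by
  have hM0 : 0 < M := by linarith
  have hx0 : 0 < M⁻¹ := inv_pos.mpr hM0
  have hx : M⁻¹ ≤ 1 / 2 := by
    rw [one_div]
    exact inv_anti₀ two_pos hM
  set a : ℕ → ℝ := fun p =>
    residualWeight (p - n) * residualWeight (p + 1) * (c0 * M⁻¹ ^ (p + 1)) with ha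
  have ha0 (p : ℕ) : 0 ≤ a p :=
    mul_nonneg (mul_nonneg (residualWeight_nonneg _) (residualWeight_nonneg _)) (by positivity)
  have has : HasSum a (inner ℝ r (Λ (lp.single 2 0 1))) := by
    have h := lp.hasSum_inner (𝕜 := ℝ) r (Λ (lp.single 2 0 1))
    refine (funext fun p => ?_ : a = _) ▸ h
    rw [hΛ.apply_zero, hr, ha]
    simp only [← eta_mul_self hc0 hM0.le, RCLike.inner_apply, conj_trivial]
    ring
  refine ⟨has.nonneg ha0, ?_⟩
  have hhead : ∑ p ∈ Finset.range (n + 1), a p = 0 := by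
    refine Finset.sum_eq_zero fun p hp => ?_
    have : p - n = 0 := by have := Finset.mem_range.mp hp; omega
    simp [ha, this, residualWeight]
  have htail : HasSum (fun p => a (p + (n + 1))) (inner ℝ r (Λ (lp.single 2 0 1))) := by
    rw [hasSum_nat_add_iff, hhead, add_zero]
    exact has
  have hgeom := (hasSum_geometric_of_lt_one hx0.le (by linarith)).mul_left
    (c0 * M⁻¹ ^ (n + 2))
  have hle := hasSum_le (fun p => ?_) htail hgeom
  · calc M ^ n * inner ℝ r (Λ (lp.single 2 0 1))
        ≤ M ^ n * (c0 * M⁻¹ ^ (n + 2) * (1 - M⁻¹)⁻¹) := by gcongr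
      _ = c0 * (M⁻¹ ^ 2 * (1 - M⁻¹)⁻¹) := by
        rw [pow_add, inv_pow M n]
        field_simp
      _ ≤ c0 * (1 / 2) := by
        gcongr
        rw [← div_eq_mul_inv, div_le_iff₀ (by linarith)]
        nlinarith
      _ = c0 / 2 := by ring
  · have h1 : residualWeight (p + (n + 1) - n) * residualWeight (p + (n + 1) + 1) ≤ 1 :=
      mul_le_one₀ (residualWeight_le_one _) (residualWeight_nonneg _) (residualWeight_le_one _)
    calc a (p + (n + 1)) ≤ 1 * (c0 * M⁻¹ ^ (p + (n + 1) + 1)) :=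
          mul_le_mul_of_nonneg_right h1 (by positivity)
      _ = c0 * M⁻¹ ^ (n + 2) * M⁻¹ ^ p := by ring

lemma lpSpec2.apply_succ_ne_zero (hΛ : lpSpec2 c0 M (9 / 50) b 5 Λ) (hc0 : 0 < c0) (hM : 0 < M)
    (hb : 0 < b) (q : ℕ) : Λ (lp.single 2 (q + 1) 1) ≠ 0 := by
  intro h
  have h1 := hΛ.apply_succ q q
  rw [h] at h1
  have h2 : 0 < eta c0 M (q + 1) := Real.sqrt_pos.mpr (by positivity)
  have h3 : 0 < Real.sqrt ((q : ℝ) + 2) := Real.sqrt_pos.mpr (by positivity)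
  have h4 : 0 < Real.sqrt ((q : ℝ) + 2) / b * (columnWeight q q * eta c0 M (q + 1)) := by
    simp only [columnWeight, if_true]
    positivity
  exact h4.ne h1

end Spec

/-- Theorem 4.7, second counterexample in sequence spaces.
For every `M ≥ 2`, `α₀ > 0` and `k = 5` there are `c₀, b > 0` and `0 < δ < 1/k` such
that for `Λ̃ = Λ e₁` the multiscale sequence coincides with `σ_n = ∑_{j=0}^n u_j`,
`u_j = (b/√(j+2)) e_{j+2}`; in particular `‖σ_n‖_{ℓ²} → +∞`. -/
theorem statement16 (M α0 : ℝ) (hM : 2 ≤ M) (hα0 : 0 < α0) (k : ℕ) (hk : k = 5) :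
    ∃ c0 b δ : ℝ, 0 < c0 ∧ 0 < b ∧ 0 < δ ∧ δ < 1 / k ∧
      ∀ Λ : lp (fun _ : ℕ => ℝ) 2 →L[ℝ] lp (fun _ : ℕ => ℝ) 2,
        lpSpec2 c0 M δ b k Λ →
        (∀ n : ℕ,
          (∀ v : lp (fun _ : ℕ => ℝ) 2,
            Jfun2 α0 M b Λ n (useq2 b n) ≤ Jfun2 α0 M b Λ n v) ∧
          (∀ v : lp (fun _ : ℕ => ℝ) 2,
            (∀ v' : lp (fun _ : ℕ => ℝ) 2, Jfun2 α0 M b Λ n v ≤ Jfun2 α0 M b Λ n v') →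
            v = useq2 b n)) ∧
        Tendsto (fun n : ℕ => ‖∑ j ∈ Finset.range (n + 1), useq2 b j‖) atTop atTop := by
  subst hk
  have hM0 : 0 < M := by linarith
  set x : ℝ := M⁻¹ with hx_def
  have hx0 : 0 < x := inv_pos.mpr hM0
  have hx : x ≤ 1 / 2 := by
    rw [hx_def, one_div]
    exact inv_anti₀ two_pos hM
  have hMx : M * x = 1 := mul_inv_cancel₀ hM0.ne'
  have hMxn (n : ℕ) : M ^ n * x ^ n = 1 := by rw [← mul_pow, hMx, one_pow]
  set b : ℝ := x * correlation x 0 0 with hb_def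
  have hb : 0 < b := mul_pos hx0 (correlation_zero_zero_pos hx0)
  have hc0 : 0 < 1 / (2 * α0) := by positivity
  refine ⟨1 / (2 * α0), b, 9 / 50, hc0, hb, by norm_num, by norm_num, fun Λ hΛ =>
    ⟨fun n => ?_, tendsto_norm_sum_useq2 hb⟩⟩
  set r : lp (fun _ : ℕ => ℝ) 2 :=
    Λ (lp.single 2 0 1) - Λ (∑ j ∈ Finset.range (n + 1), useq2 b j) with hr_def
  have hr (p : ℕ) : r p = residualWeight (p - n) * eta (1 / (2 * α0)) M (p + 1) := by
    rw [hr_def, hΛ.residual_apply hb, Nat.add_sub_add_right]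
  have hG (q : ℕ) : 2 * (α0 * M ^ n) * inner ℝ r (Λ (lp.single 2 (q + 1) 1)) =
      Real.sqrt ((q : ℝ) + 2) * (x * (M ^ n * x ^ q * correlation x n q) / b) := by
    rw [hΛ.inner_apply_succ hc0.le hM0.le hr, ← hx_def]
    field_simp
    ring
  have hcast (q : ℕ) : ((q + 1 : ℕ) : ℝ) + 1 = (q : ℝ) + 2 := by push_cast; ring
  have hs : 2 * (α0 * M ^ n) * inner ℝ r (Λ (lp.single 2 (n + 1) 1)) =
      Real.sqrt (((n + 1 : ℕ) : ℝ) + 1) := by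
    rw [hG, hMxn, one_mul, correlation_self, ← hb_def, div_self hb.ne', mul_one, hcast]
  have hne (j : ℕ) (hj : j ≠ n + 1) :
      |2 * (α0 * M ^ n) * inner ℝ r (Λ (lp.single 2 j 1))| < Real.sqrt ((j : ℝ) + 1) := by
    rcases j with _ | q
    · obtain ⟨h0, h1⟩ := hΛ.inner_apply_zero hc0.le hM hr
      rw [abs_of_nonneg (by positivity)]
      have h2 := mul_le_mul_of_nonneg_left h1 (show 0 ≤ 2 * α0 by positivity)
      have h3 : 2 * α0 * (1 / (2 * α0) / 2) = 1 / 2 := by field_simp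
      rw [h3] at h2
      norm_num
      linarith
    · have hlt : M ^ n * x ^ q * correlation x n q < correlation x 0 0 := by
        rcases lt_or_gt_of_ne (show q ≠ n by omega) with h | h
        · obtain ⟨l, rfl⟩ := Nat.exists_eq_add_of_lt h
          calc M ^ (q + l + 1) * x ^ q * correlation x (q + l + 1) q
              = M ^ (l + 1) * (M ^ q * x ^ q) * correlation x (q + (l + 1)) q := by ring_nf
            _ < M ^ (l + 1) * (M ^ q * x ^ q) * (x ^ (l + 1) * correlation x 0 0) := by
              rw [hMxn]
              gcongr
              exact correlation_lt_pow_mul hx0 q (l + 1) (by omega)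
            _ = (M ^ (l + 1) * x ^ (l + 1)) * (M ^ q * x ^ q) * correlation x 0 0 := by ring
            _ = correlation x 0 0 := by rw [hMxn, hMxn, one_mul, one_mul]
        · obtain ⟨l, rfl⟩ := Nat.exists_eq_add_of_lt h
          calc M ^ n * x ^ (n + l + 1) * correlation x n (n + l + 1)
              = (M ^ n * x ^ n) * (x ^ (l + 1) * correlation x n (n + (l + 1))) := by ring_nf
            _ < correlation x 0 0 := by
              rw [hMxn, one_mul]
              exact pow_mul_correlation_lt hx0 hx n (l + 1) (by omega)
      have hnn := correlation_nonneg hx0.le n q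
      rw [hG, abs_of_nonneg (by positivity), hcast]
      refine mul_lt_of_lt_one_right (Real.sqrt_pos.mpr (by positivity)) ?_
      rw [div_lt_one hb]
      exact mul_lt_mul_of_pos_left hlt hx0
  have hJ (v : lp (fun _ : ℕ => ℝ) 2) : Jfun2 α0 M b Λ n v =
      ENNReal.ofReal (α0 * M ^ n * ‖r - Λ (v - useq2 b n)‖ ^ 2) + Rl2 v := by
    have : Λ (lp.single 2 0 1) - Λ ((∑ j ∈ Finset.range n, useq2 b j) + v) =
        r - Λ (v - useq2 b n) := by
      rw [hr_def, Finset.sum_range_succ, map_add, map_add, map_sub]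
      abel
    rw [Jfun2, this]
  have hJu : Jfun2 α0 M b Λ n (useq2 b n) =
      ENNReal.ofReal (α0 * M ^ n * ‖r‖ ^ 2) + Rl2 (useq2 b n) := by
    rw [hJ, sub_self, map_zero, sub_zero]
  have hmin (v : lp (fun _ : ℕ => ℝ) 2) :
      Jfun2 α0 M b Λ n (useq2 b n) ≤ Jfun2 α0 M b Λ n v ∧
        (Jfun2 α0 M b Λ n v ≤ Jfun2 α0 M b Λ n (useq2 b n) → v = useq2 b n) := by
    rw [hJu, hJ v]
    exact single_isStrictMin Λ r (div_pos hb (Real.sqrt_pos.mpr (by positivity)))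
      (by positivity) (n + 1) hs hne (hΛ.apply_succ_ne_zero hc0 hM0 hb n) v
  exact ⟨fun v => (hmin v).1, fun v hv => (hmin v).2 (hv _)⟩
end
end

section
/- The operator Λ : L²(ℝ) → L²(ℝ) defined by Λ(u) = Σ_{j≥1} γ_j Λ(e_j) for u = Σ_{j≥1} γ_j e_j ∈ H̃ (with Λ(e_j) for j ≥ 2 given by (√j/b)[ Σ_{i=1}^k A_i η_{j+i−2} e_{j+i−2} + μ_{j+k−2} e_{j+k−2} − μ_{j+k−1} e_{j+k−1} ] and Λ(e_1) = Σ_{m=1}^k C_m η_m e_m + Σ_{m≥k+1} η_m e_m + μ_k e_k) and Λ(v+z) = v+z for v ∈ K and z ∈ P, is a bounded linear injective operator; moreover, for every λ > 0 and every Λ̃ ∈ L²(ℝ), the problem min{ λ‖Λ̃ − Λ(w)‖²_{L²(ℝ)} + ‖w‖_{BV(ℝ)} : w ∈ L²(ℝ) } admits a unique solution. -/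
open Filter MeasureTheory
open scoped ENNReal Topology

noncomputable section

/-- Left endpoints of the intervals `I_j`:  `a_1 = 0`, `b_j = a_j + 4/j`,
`a_{j+1} = b_j + j²` (the Lean index `j` corresponds to the paper index `j + 1`). -/
def aseq (j : ℕ) : ℝ := ∑ i ∈ Finset.range j, (4 / ((i : ℝ) + 1) + ((i : ℝ) + 1) ^ 2)

/-- Right endpoints of the intervals `I_j`. -/
def bseq (j : ℕ) : ℝ := aseq j + 4 / ((j : ℝ) + 1)

/-- `e_j = (−1)^j (√j/2) χ_{I_j}` (paper index `j` is the Lean index `j − 1`),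
an orthonormal system in `L²(ℝ)`. -/
def ef (j : ℕ) : Lp ℝ 2 (volume : Measure ℝ) :=
  ((-1 : ℝ) ^ (j + 1) * (Real.sqrt ((j : ℝ) + 1) / 2)) •
    indicatorConstLp 2 (measurableSet_Icc (a := aseq j) (b := bseq j))
      (by rw [Real.volume_Icc]; exact ENNReal.ofReal_ne_top) (1 : ℝ)

/-- `χ_{L_j}` with `L_j = (b_j, a_{j+1})`. -/
def chiL (j : ℕ) : Lp ℝ 2 (volume : Measure ℝ) :=
  indicatorConstLp 2 (measurableSet_Ioo (a := bseq j) (b := aseq (j + 1)))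
    (by rw [Real.volume_Ioo]; exact ENNReal.ofReal_ne_top) (1 : ℝ)

/-- `H̃`, the closure of the span of the `e_j`. -/
def Htilde : Submodule ℝ (Lp ℝ 2 (volume : Measure ℝ)) :=
  (Submodule.span ℝ (Set.range ef)).topologicalClosure

/-- `K = { v ∈ L²(ℝ) : v = ∑_j κ_j χ_{L_j}` for some `κ ∈ ℓ^∞ }`. -/
def Kset : Set (Lp ℝ 2 (volume : Measure ℝ)) :=
  {v | ∃ κ : ℕ → ℝ, (∃ C : ℝ, ∀ j, |κ j| ≤ C) ∧ HasSum (fun j => κ j • chiL j) v}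

/-- `P = (H̃ + K)^⊥`. -/
def Pspace : Submodule ℝ (Lp ℝ 2 (volume : Measure ℝ)) :=
  (Htilde ⊔ Submodule.span ℝ Kset)ᗮ

/-- The defining properties of the blurring operator `Λ : L²(ℝ) → L²(ℝ)`:
on the orthonormal system `{e_j}` it acts by the prescribed combinations, and it is the
identity on `K` and on `P`. -/
def LamSpec (c0 M δ b : ℝ) (k : ℕ)
    (Λ : Lp ℝ 2 (volume : Measure ℝ) →L[ℝ] Lp ℝ 2 (volume : Measure ℝ)) : Prop :=
  (Λ (ef 0) =
      (∑ m ∈ Finset.Icc 1 k, (Ccoef k δ m * eta c0 M m) • ef (m - 1)) +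
      (∑' m : ℕ, if k ≤ m then eta c0 M (m + 1) • ef m else 0) +
      (mu c0 M δ k) • ef (k - 1)) ∧
  (∀ j : ℕ, 1 ≤ j →
    Λ (ef j) = (Real.sqrt ((j : ℝ) + 1) / b) •
      ((∑ i ∈ Finset.Icc 1 k, (Acoef k δ i * eta c0 M (j + i - 1)) • ef (j + i - 2)) +
        (mu c0 M δ (j + k - 1)) • ef (j + k - 2) -
        (mu c0 M δ (j + k)) • ef (j + k - 1))) ∧
  (∀ v ∈ Kset, Λ v = v) ∧
  (∀ z ∈ Pspace, Λ z = z)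

/-- The homogeneous `BV` norm of (the equivalence class) `w ∈ L²(ℝ)`: the infimum of the
total variations of the representatives of `w` (`+∞` if `w` has no `BV` representative). -/
def BVnorm (w : Lp ℝ 2 (volume : Measure ℝ)) : ℝ≥0∞ :=
  sInf ((fun g : ℝ → ℝ => eVariationOn g Set.univ) '' {g : ℝ → ℝ | g =ᵐ[volume] ⇑w})

section Hilbert

variable {E : Type*} [NormedAddCommGroup E] [InnerProductSpace ℝ E]

lemma Orthonormal.norm_sq_sum_smul {e : ℕ → E} (he : Orthonormal ℝ e) (s : Finset ℕ) (a : ℕ → ℝ) :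
    ‖∑ j ∈ s, a j • e j‖ ^ 2 = ∑ j ∈ s, a j ^ 2 := by
  rw [← real_inner_self_eq_norm_sq, he.inner_sum]
  simp [sq]

lemma Orthonormal.hasSum_inner_smul_of_mem_closure [CompleteSpace E] {e : ℕ → E}
    (he : Orthonormal ℝ e) {x : E}
    (hx : x ∈ (Submodule.span ℝ (Set.range e)).topologicalClosure) :
    HasSum (fun j => (inner ℝ (e j) x) • e j) x := by
  have hs : Summable (fun j => (inner ℝ (e j) x) • e j) := by
    have := he.orthogonalFamily.summable_iff_norm_sq_summable (fun j => (inner ℝ (e j) x : ℝ))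
    simp only [LinearIsometry.toSpanSingleton_apply] at this
    rw [this]
    exact he.inner_products_summable x
  obtain ⟨y, hy⟩ := hs
  have hymem : y ∈ (Submodule.span ℝ (Set.range e)).topologicalClosure := by
    refine (Submodule.isClosed_topologicalClosure _).mem_of_tendsto hy (Eventually.of_forall ?_)
    intro s
    refine Submodule.sum_mem _ fun j _ => Submodule.smul_mem _ _ ?_
    exact Submodule.le_topologicalClosure _ (Submodule.subset_span ⟨j, rfl⟩)
  have hinner : ∀ j, inner ℝ (e j) y = inner ℝ (e j) x := by
    intro j
    have h1 := hy.mapL (innerSL ℝ (e j))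
    have h2 : HasSum (fun i => innerSL ℝ (e j) ((inner ℝ (e i) x) • e i))
        (inner ℝ (e j) x : ℝ) := by
      convert hasSum_single j ?_ using 1
      · simp [he.1 j]
      · intro i hi
        simp [he.2 hi.symm]
    exact h1.unique h2
  have horth : x - y ∈ (Submodule.span ℝ (Set.range e)).topologicalClosureᗮ := by
    rw [Submodule.orthogonal_closure]
    rw [Submodule.mem_orthogonal]
    intro u hu
    induction hu using Submodule.span_induction with
    | mem u hu => obtain ⟨j, rfl⟩ := hu; rw [inner_sub_right, hinner, sub_self]
    | zero => simp
    | add u v _ _ hu hv => rw [inner_add_left, hu, hv, add_zero]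
    | smul a u _ hu => rw [inner_smul_left, hu, mul_zero]
  have h0 := (Submodule.mem_orthogonal _ _).1 horth _ (Submodule.sub_mem _ hx hymem)
  rw [inner_self_eq_zero, sub_eq_zero] at h0
  subst h0
  exact hy

/-- Weighted `ℓ²` bounds on the coefficients give a uniform bound on the tails. -/
lemma Orthonormal.norm_sq_sub_partialSum_le [CompleteSpace E] {e : ℕ → E} (he : Orthonormal ℝ e)
    {x : E} (hx : x ∈ (Submodule.span ℝ (Set.range e)).topologicalClosure) {R : ℝ}
    (hR : ∀ N : ℕ, ∑ j ∈ Finset.range N, ((j : ℝ) + 1) * (inner ℝ (e j) x) ^ 2 ≤ R) (N : ℕ) :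
    ‖x - ∑ j ∈ Finset.range N, (inner ℝ (e j) x) • e j‖ ^ 2 ≤ R / (N + 1) := by
  have ht := (he.hasSum_inner_smul_of_mem_closure hx).tendsto_sum_nat
  have ht' := ((ht.sub_const (∑ j ∈ Finset.range N, (inner ℝ (e j) x) • e j)).norm).pow 2
  refine le_of_tendsto ht' ?_
  filter_upwards [eventually_ge_atTop N] with m hm
  rw [← Finset.sum_Ico_eq_sub _ hm, he.norm_sq_sum_smul, le_div_iff₀ (by positivity),
    Finset.sum_mul]
  refine le_trans ?_ (hR m)
  calc _ ≤ ∑ j ∈ Finset.Ico N m, ((j : ℝ) + 1) * (inner ℝ (e j) x) ^ 2 := by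
        refine Finset.sum_le_sum fun j hj => ?_
        rw [mul_comm]
        have : (N : ℝ) ≤ j := by exact_mod_cast (Finset.mem_Ico.1 hj).1
        gcongr
    _ ≤ _ := by
        refine Finset.sum_le_sum_of_subset_of_nonneg ?_ fun j _ _ => by positivity
        intro j hj
        exact Finset.mem_range.2 (Finset.mem_Ico.1 hj).2

/-- Compactness of sets with weighted `ℓ²` bounds on the coefficients. -/
lemma Orthonormal.exists_tendsto_subseq [CompleteSpace E] {e : ℕ → E} (he : Orthonormal ℝ e)
    {x : ℕ → E} (hx : ∀ n, x n ∈ (Submodule.span ℝ (Set.range e)).topologicalClosure) {R : ℝ}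
    (hR : ∀ n N : ℕ, ∑ j ∈ Finset.range N, ((j : ℝ) + 1) * (inner ℝ (e j) (x n)) ^ 2 ≤ R) :
    ∃ (y : E) (φ : ℕ → ℕ), StrictMono φ ∧ Tendsto (x ∘ φ) atTop (𝓝 y) := by
  have hR0 : 0 ≤ R := by simpa using hR 0 0
  have hK : IsCompact (Set.univ.pi fun _ : ℕ => Set.Icc (-√R) (√R)) :=
    isCompact_univ_pi fun _ => isCompact_Icc
  have hmem : ∀ n, (fun j => (inner ℝ (e j) (x n) : ℝ)) ∈
      Set.univ.pi fun _ : ℕ => Set.Icc (-√R) (√R) := by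
    intro n j _
    refine abs_le.1 ?_
    refine Real.abs_le_sqrt ?_
    have h1 := hR n (j + 1)
    rw [Finset.sum_range_succ] at h1
    have h2 : 0 ≤ ∑ j ∈ Finset.range j, ((j : ℝ) + 1) * (inner ℝ (e j) (x n)) ^ 2 :=
      Finset.sum_nonneg fun j _ => by positivity
    have h3 : 0 ≤ (j : ℝ) * (inner ℝ (e j) (x n)) ^ 2 := by positivity
    linarith
  obtain ⟨γ, -, φ, hφ, hlim⟩ := hK.tendsto_subseq hmem
  have hc : CauchySeq (x ∘ φ) := by
    have hpart : ∀ N : ℕ, CauchySeq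
        (fun n => ∑ j ∈ Finset.range N, (inner ℝ (e j) (x (φ n))) • e j) := by
      intro N
      refine Tendsto.cauchySeq (x := ∑ j ∈ Finset.range N, γ j • e j) ?_
      refine tendsto_finsetSum _ fun j _ => ?_
      exact ((tendsto_pi_nhds.1 hlim) j).smul_const _
    rw [Metric.cauchySeq_iff]
    intro ε hε
    obtain ⟨N, hN⟩ : ∃ N : ℕ, R / (N + 1) < (ε / 3) ^ 2 := by
      have := (tendsto_const_div_atTop_nhds_zero_nat R).comp (tendsto_add_atTop_nat 1)
      obtain ⟨N, hN⟩ := (this.eventually_lt_const (show (0:ℝ) < (ε / 3) ^ 2 by positivity)).exists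
      exact ⟨N, by simpa using hN⟩
    obtain ⟨n₀, hn₀⟩ := Metric.cauchySeq_iff.1 (hpart N) (ε / 3) (by positivity)
    refine ⟨n₀, fun m hm n hn => ?_⟩
    have key : ∀ i, dist (x (φ i))
        (∑ j ∈ Finset.range N, (inner ℝ (e j) (x (φ i))) • e j) < ε / 3 := by
      intro i
      rw [dist_eq_norm]
      exact lt_of_pow_lt_pow_left₀ 2 (by positivity)
        ((he.norm_sq_sub_partialSum_le (hx _) (hR _) N).trans_lt hN)
    have h1 := key m
    have h2 := key n
    rw [dist_comm] at h2
    have h3 := hn₀ m hm n hn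
    have h4 := dist_triangle4 (x (φ m)) (∑ j ∈ Finset.range N, (inner ℝ (e j) (x (φ m))) • e j)
      (∑ j ∈ Finset.range N, (inner ℝ (e j) (x (φ n))) • e j) (x (φ n))
    simp only [Function.comp]
    linarith
  obtain ⟨y, hy⟩ := cauchySeq_tendsto_of_complete hc
  exact ⟨y, φ, hφ, hy⟩

end Hilbert

lemma eVariationOn.exists_extension (f : ℝ → ℝ) (S : Set ℝ) (hf : eVariationOn f S ≠ ⊤) :
    ∃ g : ℝ → ℝ, Set.EqOn g f S ∧ eVariationOn g Set.univ ≤ eVariationOn f S := by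
  set V : ℝ → ℝ := fun x => (eVariationOn f (S ∩ Set.Iic x)).toReal with hV
  have hfin : ∀ x, eVariationOn f (S ∩ Set.Iic x) ≠ ⊤ := fun x =>
    ne_top_of_le_ne_top hf (eVariationOn.mono f Set.inter_subset_left)
  have hVmono : Monotone V := fun x y hxy =>
    ENNReal.toReal_mono (hfin y)
      (eVariationOn.mono f (Set.inter_subset_inter_right _ (Set.Iic_subset_Iic.2 hxy)))
  have hdist : ∀ x ∈ S, ∀ y ∈ S, x ≤ y → dist (f x) (f y) ≤ V y - V x := by
    intro x hx y hy hxy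
    have h1 : eVariationOn f (S ∩ Set.Iic x) + edist (f x) (f y)
        ≤ eVariationOn f (S ∩ Set.Iic y) := by
      calc _ ≤ eVariationOn f (S ∩ Set.Iic x) + eVariationOn f (S ∩ Set.Icc x y) := by
            gcongr
            exact eVariationOn.edist_le f ⟨hx, le_rfl, hxy⟩ ⟨hy, hxy, le_rfl⟩
        _ ≤ eVariationOn f ((S ∩ Set.Iic x) ∪ (S ∩ Set.Icc x y)) :=
            eVariationOn.add_le_union f fun a ha b hb => ha.2.trans hb.2.1
        _ ≤ _ := by
            refine eVariationOn.mono f (Set.union_subset ?_ ?_)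
            · exact Set.inter_subset_inter_right _ (Set.Iic_subset_Iic.2 hxy)
            · exact Set.inter_subset_inter_right _ fun z hz => hz.2
    have h2 := ENNReal.toReal_mono (hfin y) h1
    rw [ENNReal.toReal_add (hfin x) (edist_ne_top _ _), ← dist_edist] at h2
    simp only [hV]
    linarith
  have hdist' : ∀ x ∈ S, ∀ y ∈ S, dist (f x) (f y) ≤ |V x - V y| := by
    intro x hx y hy
    rcases le_total x y with h | h
    · rw [abs_sub_comm]
      exact (hdist x hx y hy h).trans (le_abs_self _)
    · rw [dist_comm]
      exact (hdist y hy x hx h).trans (le_abs_self _)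
  obtain ⟨φ, hφ⟩ : ∃ φ : ℝ → ℝ, ∀ x ∈ S, φ (V x) = f x := by
    classical
    refine ⟨fun t => if h : ∃ x ∈ S, V x = t then f h.choose else 0, fun x hx => ?_⟩
    have h : ∃ y ∈ S, V y = V x := ⟨x, hx, rfl⟩
    simp only [dif_pos h]
    have h1 := hdist' _ h.choose_spec.1 x hx
    rw [h.choose_spec.2, sub_self, abs_zero] at h1
    exact dist_le_zero.1 h1
  have hφL : LipschitzOnWith 1 φ (V '' S) := by
    refine LipschitzOnWith.of_dist_le_mul ?_
    rintro _ ⟨x, hx, rfl⟩ _ ⟨y, hy, rfl⟩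
    rw [hφ x hx, hφ y hy, NNReal.coe_one, one_mul, Real.dist_eq (V x)]
    exact hdist' x hx y hy
  obtain ⟨ψ, hψ, hψφ⟩ := hφL.extend_real
  refine ⟨ψ ∘ V, fun x hx => ?_, ?_⟩
  · rw [← hφ x hx]
    exact (hψφ ⟨x, hx, rfl⟩).symm
  · have hmaps : Set.MapsTo V Set.univ (Set.Icc 0 (eVariationOn f S).toReal) := fun x _ =>
      ⟨ENNReal.toReal_nonneg,
        ENNReal.toReal_mono hf (eVariationOn.mono f Set.inter_subset_left)⟩
    calc eVariationOn (ψ ∘ V) Set.univ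
        ≤ eVariationOn ψ (Set.Icc 0 (eVariationOn f S).toReal) :=
          eVariationOn.comp_le_of_monotoneOn _ V (hVmono.monotoneOn _) hmaps
      _ ≤ (1 : NNReal) * eVariationOn id (Set.Icc 0 (eVariationOn f S).toReal) :=
          hψ.lipschitzOnWith.comp_eVariationOn_le (Set.mapsTo_univ _ _)
      _ = eVariationOn f S := by
          rw [eVariationOn_id_Icc, sub_zero, ENNReal.ofReal_toReal hf]
          simp

lemma eVariationOn.midpoint_le (f g : ℝ → ℝ) (s : Set ℝ) :
    eVariationOn (fun x => (1 / 2 : ℝ) * (f x + g x)) s ≤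
      (eVariationOn f s + eVariationOn g s) / 2 := by
  have hpt : ∀ x y, edist ((1 / 2 : ℝ) * (f x + g x)) ((1 / 2 : ℝ) * (f y + g y)) ≤
      (edist (f x) (f y) + edist (g x) (g y)) / 2 := by
    intro x y
    rw [edist_dist, edist_dist, edist_dist, ← ENNReal.ofReal_add dist_nonneg dist_nonneg,
      show (2 : ℝ≥0∞) = ENNReal.ofReal 2 by simp, ← ENNReal.ofReal_div_of_pos two_pos]
    refine ENNReal.ofReal_le_ofReal ?_
    simp only [Real.dist_eq]
    rw [show (1 / 2 : ℝ) * (f x + g x) - (1 / 2 : ℝ) * (f y + g y) =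
      ((f x - f y) + (g x - g y)) / 2 by ring, abs_div, abs_two]
    gcongr
    exact abs_add_le _ _
  refine iSup_le ?_
  rintro ⟨n, u, hu, hus⟩
  calc _ ≤ ∑ i ∈ Finset.range n,
        (edist (f (u (i + 1))) (f (u i)) + edist (g (u (i + 1))) (g (u i))) / 2 :=
        Finset.sum_le_sum fun i _ => hpt _ _
    _ = (∑ i ∈ Finset.range n, edist (f (u (i + 1))) (f (u i)) +
        ∑ i ∈ Finset.range n, edist (g (u (i + 1))) (g (u i))) / 2 := by
        simp only [div_eq_mul_inv]
        rw [← Finset.sum_mul, Finset.sum_add_distrib]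
    _ ≤ _ := by
        gcongr
        · exact eVariationOn.sum_le hu hus
        · exact eVariationOn.sum_le hu hus

lemma ENNReal.le_add_of_forall_gt {x a b : ℝ≥0∞} (h : ∀ a' > a, ∀ b' > b, x ≤ a' + b') :
    x ≤ a + b := by
  have h1 : ∀ a' > a, x ≤ a' + b := fun a' ha' =>
    tsub_le_iff_left.1 (le_of_forall_gt_imp_ge_of_dense fun b' hb' =>
      tsub_le_iff_left.2 (h a' ha' b' hb'))
  exact tsub_le_iff_right.1 (le_of_forall_gt_imp_ge_of_dense fun a' ha' =>
    tsub_le_iff_right.2 (h1 a' ha'))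

lemma exists_ae_eq_eVariationOn_lt {w : Lp ℝ 2 (volume : Measure ℝ)} {c : ℝ≥0∞}
    (h : BVnorm w < c) : ∃ g : ℝ → ℝ, g =ᵐ[volume] ⇑w ∧ eVariationOn g Set.univ < c := by
  obtain ⟨_, ⟨g, hg, rfl⟩, hlt⟩ := sInf_lt_iff.1 h
  exact ⟨g, hg, hlt⟩

lemma BVnorm_le_of_ae_eq {w : Lp ℝ 2 (volume : Measure ℝ)} {g : ℝ → ℝ} (hg : g =ᵐ[volume] ⇑w) :
    BVnorm w ≤ eVariationOn g Set.univ :=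
  sInf_le ⟨g, hg, rfl⟩

lemma BVnorm_zero : BVnorm 0 = 0 := by
  refine le_antisymm ?_ zero_le
  have h : (fun _ : ℝ => (0 : ℝ)) =ᵐ[volume] ⇑(0 : Lp ℝ 2 (volume : Measure ℝ)) :=
    (Lp.coeFn_zero ℝ 2 volume).symm
  refine (BVnorm_le_of_ae_eq h).trans (le_of_eq ?_)
  exact eVariationOn.constant_on (by rintro _ ⟨_, _, rfl⟩ _ ⟨_, _, rfl⟩; rfl)

lemma BVnorm_midpoint_le (u v : Lp ℝ 2 (volume : Measure ℝ)) :
    BVnorm ((1 / 2 : ℝ) • (u + v)) ≤ (BVnorm u + BVnorm v) / 2 := by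
  rw [ENNReal.le_div_iff_mul_le (by simp) (by simp)]
  refine ENNReal.le_add_of_forall_gt fun a ha c hc => ?_
  rw [← ENNReal.le_div_iff_mul_le (by simp) (by simp)]
  obtain ⟨f, hf, hfa⟩ := exists_ae_eq_eVariationOn_lt ha
  obtain ⟨g, hg, hgc⟩ := exists_ae_eq_eVariationOn_lt hc
  have hmid : (fun x => (1 / 2 : ℝ) * (f x + g x)) =ᵐ[volume] ⇑((1 / 2 : ℝ) • (u + v)) := by
    filter_upwards [hf, hg, Lp.coeFn_smul (1 / 2 : ℝ) (u + v), Lp.coeFn_add u v]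
      with x h1 h2 h3 h4
    rw [h3, Pi.smul_apply, h4, Pi.add_apply, h1, h2, smul_eq_mul]
  refine (BVnorm_le_of_ae_eq hmid).trans ((eVariationOn.midpoint_le f g _).trans ?_)
  gcongr

lemma BVnorm_le_of_tendsto {w : ℕ → Lp ℝ 2 (volume : Measure ℝ)}
    {w₀ : Lp ℝ 2 (volume : Measure ℝ)} (hw : Tendsto w atTop (𝓝 w₀)) {c : ℝ≥0∞}
    (hc : ∀ᶠ n in atTop, BVnorm (w n) ≤ c) : BVnorm w₀ ≤ c := by
  refine le_of_forall_gt_imp_ge_of_dense fun c' hc' => ?_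
  rcases eq_or_ne c' ⊤ with rfl | hc'top
  · exact le_top
  obtain ⟨n₀, hn₀⟩ := eventually_atTop.1 hc
  have hex : ∀ n, ∃ g : ℝ → ℝ, g =ᵐ[volume] ⇑(w (n + n₀)) ∧ eVariationOn g Set.univ < c' :=
    fun n => exists_ae_eq_eVariationOn_lt ((hn₀ _ (by lia)).trans_lt hc')
  choose g hg hgc using hex
  have hw' : Tendsto (fun n => w (n + n₀)) atTop (𝓝 w₀) := hw.comp (tendsto_add_atTop_nat n₀)
  obtain ⟨φ, -, hφ⟩ := (tendstoInMeasure_of_tendsto_Lp hw').exists_seq_tendsto_ae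
  set S : Set ℝ := {x | (∀ n, g n x = w (n + n₀) x) ∧
    Tendsto (fun n => w (φ n + n₀) x) atTop (𝓝 (w₀ x))} with hS
  have hSae : ∀ᵐ x ∂(volume : Measure ℝ), x ∈ S := by
    filter_upwards [ae_all_iff.2 hg, hφ] with x h1 h2 using ⟨h1, h2⟩
  have hvar : eVariationOn (⇑w₀) S ≤ c' := by
    by_contra hlt
    rw [not_le] at hlt
    have hev := eVariationOn.lowerSemicontinuous_aux (F := fun n => g (φ n)) (p := atTop)
      (f := ⇑w₀) (s := S) (fun x hx => by
        refine hx.2.congr fun n => ?_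
        exact (hx.1 (φ n)).symm) hlt
    obtain ⟨n, hn⟩ := hev.exists
    exact absurd (hn.trans_le (eVariationOn.mono _ (Set.subset_univ _))) (not_lt.2 (hgc _).le)
  obtain ⟨h, hh, hhv⟩ := eVariationOn.exists_extension (⇑w₀) S (ne_top_of_le_ne_top hc'top hvar)
  have hae : h =ᵐ[volume] ⇑w₀ := by
    filter_upwards [hSae] with x hx using hh hx
  exact (BVnorm_le_of_ae_eq hae).trans (hhv.trans hvar)

lemma aseq_succ (j : ℕ) : aseq (j + 1) = bseq j + ((j : ℝ) + 1) ^ 2 := by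
  rw [bseq, aseq, Finset.sum_range_succ, ← aseq]
  ring

lemma aseq_lt_bseq (j : ℕ) : aseq j < bseq j := by
  rw [bseq, lt_add_iff_pos_right]
  positivity

lemma bseq_lt_aseq_succ (j : ℕ) : bseq j < aseq (j + 1) := by
  rw [aseq_succ, lt_add_iff_pos_right]
  positivity

lemma aseq_monotone : Monotone aseq :=
  monotone_nat_of_le_succ fun j => ((aseq_lt_bseq j).trans (bseq_lt_aseq_succ j)).le

lemma bseq_lt_aseq {i j : ℕ} (h : i < j) : bseq i < aseq j :=
  (bseq_lt_aseq_succ i).trans_le (aseq_monotone h)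

lemma Icc_inter_Icc_aseq {i j : ℕ} (h : i ≠ j) :
    Set.Icc (aseq i) (bseq i) ∩ Set.Icc (aseq j) (bseq j) = ∅ := by
  ext x
  simp only [Set.mem_inter_iff, Set.mem_Icc, Set.mem_empty_iff_false, iff_false]
  rintro ⟨⟨h1, h2⟩, h3, h4⟩
  rcases lt_or_gt_of_ne h with h | h <;> linarith [bseq_lt_aseq h]

lemma Icc_inter_Ioo_aseq (i j : ℕ) :
    Set.Icc (aseq i) (bseq i) ∩ Set.Ioo (bseq j) (aseq (j + 1)) = ∅ := by
  ext x
  simp only [Set.mem_inter_iff, Set.mem_Icc, Set.mem_Ioo, Set.mem_empty_iff_false, iff_false]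
  rintro ⟨⟨h1, h2⟩, h3, h4⟩
  rcases lt_trichotomy i j with h | rfl | h
  · linarith [bseq_lt_aseq h, aseq_lt_bseq j]
  · linarith
  · linarith [aseq_monotone (Nat.succ_le_of_lt h)]

lemma Ioo_inter_Ioo_aseq {i j : ℕ} (h : i ≠ j) :
    Set.Ioo (bseq i) (aseq (i + 1)) ∩ Set.Ioo (bseq j) (aseq (j + 1)) = ∅ := by
  ext x
  simp only [Set.mem_inter_iff, Set.mem_Ioo, Set.mem_empty_iff_false, iff_false]
  rintro ⟨⟨h1, h2⟩, h3, h4⟩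
  rcases lt_or_gt_of_ne h with h | h
  · linarith [aseq_monotone (Nat.succ_le_of_lt h), aseq_lt_bseq j]
  · linarith [aseq_monotone (Nat.succ_le_of_lt h), aseq_lt_bseq i]

lemma inner_ef (j : ℕ) (w : Lp ℝ 2 (volume : Measure ℝ)) :
    inner ℝ (ef j) w = ((-1 : ℝ) ^ (j + 1) * (√((j : ℝ) + 1) / 2)) *
      ∫ x in Set.Icc (aseq j) (bseq j), w x := by
  rw [ef, real_inner_smul_left, L2.inner_indicatorConstLp_one]

lemma inner_chiL (j : ℕ) (w : Lp ℝ 2 (volume : Measure ℝ)) :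
    inner ℝ (chiL j) w = ∫ x in Set.Ioo (bseq j) (aseq (j + 1)), w x := by
  rw [chiL, L2.inner_indicatorConstLp_one]

lemma orthonormal_ef : Orthonormal ℝ ef := by
  constructor
  · intro j
    rw [← sq_eq_sq₀ (norm_nonneg _) zero_le_one, ← real_inner_self_eq_norm_sq, ef,
      real_inner_smul_left, real_inner_smul_right,
      L2.real_inner_indicatorConstLp_one_indicatorConstLp_one
      measurableSet_Icc measurableSet_Icc measure_Icc_lt_top.ne measure_Icc_lt_top.ne, Set.inter_self, Measure.real,
      Real.volume_Icc, bseq, add_sub_cancel_left, ENNReal.toReal_ofReal (by positivity)]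
    have h1 : ((-1 : ℝ) ^ (j + 1)) * (-1 : ℝ) ^ (j + 1) = 1 := by
      rw [← mul_pow]; simp
    have h2 : √((j : ℝ) + 1) * √((j : ℝ) + 1) = j + 1 := Real.mul_self_sqrt (by positivity)
    calc _ = (((-1 : ℝ) ^ (j + 1)) * (-1 : ℝ) ^ (j + 1)) *
          (√((j : ℝ) + 1) * √((j : ℝ) + 1)) / (j + 1) := by ring
      _ = 1 ^ 2 := by
        rw [h1, h2]
        field_simp
  · intro i j hij
    rw [ef, ef, real_inner_smul_left, real_inner_smul_right,
      L2.real_inner_indicatorConstLp_one_indicatorConstLp_one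
      measurableSet_Icc measurableSet_Icc measure_Icc_lt_top.ne measure_Icc_lt_top.ne, Icc_inter_Icc_aseq hij]
    simp

lemma inner_ef_chiL (i j : ℕ) : inner ℝ (ef i) (chiL j) = 0 := by
  rw [ef, chiL, real_inner_smul_left,
    L2.real_inner_indicatorConstLp_one_indicatorConstLp_one
      measurableSet_Icc measurableSet_Ioo measure_Icc_lt_top.ne measure_Ioo_lt_top.ne, Icc_inter_Ioo_aseq]
  simp

lemma orthonormal_smul_chiL : Orthonormal ℝ fun j : ℕ => ((j : ℝ) + 1)⁻¹ • chiL j := by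
  constructor
  · intro j
    change ‖((j : ℝ) + 1)⁻¹ • chiL j‖ = 1
    rw [← sq_eq_sq₀ (norm_nonneg _) zero_le_one, ← real_inner_self_eq_norm_sq, chiL,
      real_inner_smul_left, real_inner_smul_right,
      L2.real_inner_indicatorConstLp_one_indicatorConstLp_one
      measurableSet_Ioo measurableSet_Ioo measure_Ioo_lt_top.ne measure_Ioo_lt_top.ne, Set.inter_self, Measure.real,
      Real.volume_Ioo, aseq_succ, add_sub_cancel_left, ENNReal.toReal_ofReal (by positivity)]
    field_simp
  · intro i j hij
    change inner ℝ (((i : ℝ) + 1)⁻¹ • chiL i) (((j : ℝ) + 1)⁻¹ • chiL j) = 0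
    rw [chiL, chiL, real_inner_smul_left, real_inner_smul_right,
      L2.real_inner_indicatorConstLp_one_indicatorConstLp_one
      measurableSet_Ioo measurableSet_Ioo measure_Ioo_lt_top.ne measure_Ioo_lt_top.ne, Ioo_inter_Ioo_aseq hij]
    simp

instance Htilde_completeSpace : CompleteSpace Htilde :=
  (Submodule.isClosed_topologicalClosure _).completeSpace_coe

lemma ef_mem_Htilde (j : ℕ) : ef j ∈ Htilde :=
  Submodule.le_topologicalClosure _ (Submodule.subset_span ⟨j, rfl⟩)

lemma mem_Htilde_orthogonal_iff {x : Lp ℝ 2 (volume : Measure ℝ)} :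
    x ∈ Htildeᗮ ↔ ∀ j, inner ℝ (ef j) x = 0 := by
  rw [Htilde, Submodule.orthogonal_closure, Submodule.mem_orthogonal]
  refine ⟨fun h j => h _ (Submodule.subset_span ⟨j, rfl⟩), fun h u hu => ?_⟩
  induction hu using Submodule.span_induction with
  | mem u hu => obtain ⟨j, rfl⟩ := hu; exact h j
  | zero => simp
  | add u v _ _ hu hv => rw [inner_add_left, hu, hv, add_zero]
  | smul a u _ hu => rw [inner_smul_left, hu, mul_zero]

lemma Kset_subset_orthogonal {v : Lp ℝ 2 (volume : Measure ℝ)} (hv : v ∈ Kset) :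
    v ∈ Htildeᗮ := by
  obtain ⟨κ, -, hκ⟩ := hv
  rw [mem_Htilde_orthogonal_iff]
  intro j
  have h1 := hκ.mapL (innerSL ℝ (ef j))
  refine h1.unique ?_
  simp [inner_ef_chiL, hasSum_zero]

lemma abs_setAverage_sub_setAverage_le {g : ℝ → ℝ} {s t : Set ℝ} {T : ℝ}
    (hs : volume s ≠ 0) (hs' : volume s ≠ ⊤) (ht : volume t ≠ 0) (ht' : volume t ≠ ⊤)
    (hgs : IntegrableOn g s) (hgt : IntegrableOn g t)
    (hT : ∀ x ∈ s, ∀ y ∈ t, |g x - g y| ≤ T) :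
    |(⨍ x in s, g x) - ⨍ x in t, g x| ≤ T := by
  obtain ⟨x, hx, hx'⟩ := exists_le_setAverage hs hs' hgs
  obtain ⟨x₂, hx₂, hx₂'⟩ := exists_setAverage_le hs hs' hgs
  obtain ⟨y, hy, hy'⟩ := exists_le_setAverage ht ht' hgt
  obtain ⟨y₂, hy₂, hy₂'⟩ := exists_setAverage_le ht ht' hgt
  have h1 := (abs_le.1 (hT x hx y₂ hy₂)).1
  have h2 := (abs_le.1 (hT x₂ hx₂ y hy)).2
  rw [abs_le]
  constructor <;> linarith

/-- A bound on the total variation and on the component orthogonal to `Htilde` controls a weighted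
`ℓ²` norm of the coefficients in the system `ef`. -/
lemma sum_mul_inner_ef_sq_le {w : Lp ℝ 2 (volume : Measure ℝ)} {C D : ℝ} (hC : 0 ≤ C)
    (hw : BVnorm w < ENNReal.ofReal C) (hD : ‖w - Htilde.starProjection w‖ ≤ D) (N : ℕ) :
    ∑ j ∈ Finset.range N, ((j : ℝ) + 1) * (inner ℝ (ef j) w) ^ 2 ≤ 8 * (D ^ 2 + C ^ 2) := by
  obtain ⟨g, hg, hgC⟩ := exists_ae_eq_eVariationOn_lt hw
  have hgtop : eVariationOn g Set.univ ≠ ⊤ := hgC.ne_top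
  set t : ℕ → ℝ := fun j => (eVariationOn g (Set.Icc (aseq j) (aseq (j + 1)))).toReal with ht
  have hfin : ∀ s, eVariationOn g s ≠ ⊤ := fun s =>
    ne_top_of_le_ne_top hgtop (eVariationOn.mono g (Set.subset_univ s))
  have ht0 : ∀ j, 0 ≤ t j := fun j => ENNReal.toReal_nonneg
  have htsum : ∑ j ∈ Finset.range N, t j ≤ C := by
    rw [ht, ← ENNReal.toReal_sum fun j _ => hfin _, eVariationOn.sum' g aseq_monotone]
    refine ENNReal.toReal_le_of_le_ofReal hC ?_
    exact (eVariationOn.mono g (Set.subset_univ _)).trans hgC.le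
  have htsq : ∑ j ∈ Finset.range N, t j ^ 2 ≤ C ^ 2 :=
    (Finset.sum_sq_le_sq_sum_of_nonneg fun j _ => ht0 j).trans (by gcongr)
  set q := w - Htilde.starProjection w with hq
  have hchi : ∀ j, inner ℝ (chiL j) w = inner ℝ (chiL j) q := by
    intro j
    have : chiL j ∈ Htildeᗮ := by
      rw [mem_Htilde_orthogonal_iff]
      exact fun i => inner_ef_chiL i j
    rw [hq, inner_sub_right, (Submodule.mem_orthogonal' _ _).1 this _
      (Submodule.starProjection_apply_mem _ _), sub_zero]
  have hbessel : ∑ j ∈ Finset.range N, (inner ℝ (((j : ℝ) + 1)⁻¹ • chiL j) q) ^ 2 ≤ D ^ 2 := by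
    have := orthonormal_smul_chiL.sum_inner_products_le (x := q) (s := Finset.range N)
    simp only [Real.norm_eq_abs, sq_abs] at this
    refine this.trans ?_
    gcongr
  have hIntOn : ∀ s, volume s ≠ ⊤ → IntegrableOn g s := fun s hs =>
    (integrableOn_Lp_of_measure_ne_top w (by norm_num) hs).congr
      (ae_restrict_of_ae hg.symm)
  have hterm : ∀ j : ℕ, ((j : ℝ) + 1) * (inner ℝ (ef j) w) ^ 2 ≤
      8 * (inner ℝ (((j : ℝ) + 1)⁻¹ • chiL j) q ^ 2 + t j ^ 2) := by
    intro j
    have hj : (0 : ℝ) < (j : ℝ) + 1 := by positivity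
    have hIw : ∫ x in Set.Icc (aseq j) (bseq j), w x = ∫ x in Set.Icc (aseq j) (bseq j), g x :=
      integral_congr_ae (ae_restrict_of_ae hg.symm)
    have hLw : ∫ x in Set.Ioo (bseq j) (aseq (j + 1)), w x =
        ∫ x in Set.Ioo (bseq j) (aseq (j + 1)), g x :=
      integral_congr_ae (ae_restrict_of_ae hg.symm)
    have hvI : volume (Set.Icc (aseq j) (bseq j)) = ENNReal.ofReal (4 / ((j : ℝ) + 1)) := by
      rw [Real.volume_Icc, bseq, add_sub_cancel_left]
    have hvL : volume (Set.Ioo (bseq j) (aseq (j + 1))) = ENNReal.ofReal (((j : ℝ) + 1) ^ 2) := by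
      rw [Real.volume_Ioo, aseq_succ, add_sub_cancel_left]
    have hvI' : volume (Set.Icc (aseq j) (bseq j)) ≠ ⊤ := by rw [hvI]; exact ENNReal.ofReal_ne_top
    have hvL' : volume (Set.Ioo (bseq j) (aseq (j + 1))) ≠ ⊤ := by
      rw [hvL]; exact ENNReal.ofReal_ne_top
    have hosc := abs_setAverage_sub_setAverage_le (g := g) (T := t j)
      (s := Set.Icc (aseq j) (bseq j)) (t := Set.Ioo (bseq j) (aseq (j + 1)))
      (by rw [hvI]; exact (ENNReal.ofReal_pos.2 (by positivity)).ne') hvI'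
      (by rw [hvL]; exact (ENNReal.ofReal_pos.2 (by positivity)).ne') hvL'
      (hIntOn _ hvI') (hIntOn _ hvL') (fun x hx y hy => by
        rw [← Real.dist_eq]
        refine BoundedVariationOn.dist_le (s := Set.Icc (aseq j) (aseq (j + 1))) (hfin _) ?_ ?_
        · exact ⟨hx.1, hx.2.trans (bseq_lt_aseq_succ j).le⟩
        · exact ⟨(aseq_lt_bseq j).le.trans hy.1.le, hy.2.le⟩)
    set A := ⨍ x in Set.Icc (aseq j) (bseq j), g x with hA
    set B := ⨍ x in Set.Ioo (bseq j) (aseq (j + 1)), g x with hB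
    have hIA : ∫ x in Set.Icc (aseq j) (bseq j), g x = 4 / ((j : ℝ) + 1) * A := by
      rw [hA, setAverage_eq, Measure.real, hvI, ENNReal.toReal_ofReal (by positivity),
        smul_eq_mul, mul_inv_cancel_left₀ (by positivity)]
    have hLB : ∫ x in Set.Ioo (bseq j) (aseq (j + 1)), g x = ((j : ℝ) + 1) ^ 2 * B := by
      rw [hB, setAverage_eq, Measure.real, hvL, ENNReal.toReal_ofReal (by positivity),
        smul_eq_mul, mul_inv_cancel_left₀ (by positivity)]
    have h1 : ((j : ℝ) + 1) * (inner ℝ (ef j) w) ^ 2 = 4 * A ^ 2 := by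
      rw [inner_ef, hIw, hIA, mul_pow, mul_pow, ← pow_mul, mul_comm (j + 1) 2, pow_mul,
        neg_one_sq, one_pow, div_pow, Real.sq_sqrt hj.le]
      field_simp
      ring
    have h2 : inner ℝ (((j : ℝ) + 1)⁻¹ • chiL j) q = ((j : ℝ) + 1) * B := by
      rw [real_inner_smul_left, ← hchi, inner_chiL, hLw, hLB]
      field_simp
    rw [h1, h2]
    have h3 : B ^ 2 ≤ (((j : ℝ) + 1) * B) ^ 2 := by
      rw [mul_pow]
      exact le_mul_of_one_le_left (sq_nonneg _) (one_le_pow₀ (by linarith [j.cast_nonneg (α := ℝ)]))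
    have h4 : (A - B) ^ 2 ≤ t j ^ 2 := by
      rw [← sq_abs]
      gcongr
    nlinarith [sq_nonneg (A - 2 * B)]
  calc _ ≤ ∑ j ∈ Finset.range N, 8 * (inner ℝ (((j : ℝ) + 1)⁻¹ • chiL j) q ^ 2 + t j ^ 2) :=
        Finset.sum_le_sum fun j _ => hterm j
    _ ≤ _ := by
        rw [← Finset.mul_sum, Finset.sum_add_distrib]
        gcongr

/-- The coefficients of the banded lower triangular Toeplitz matrix of the blurring operator. -/
def toeplitzCoef (k : ℕ) (δ : ℝ) (i : ℕ) : ℝ :=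
  if i = 0 then 1 - k * δ else if i ≤ k then δ else 0

/-- The prescribed image of `ef j` under the blurring operator. -/
def blurImage (c0 M δ b : ℝ) (k j : ℕ) : Lp ℝ 2 (volume : Measure ℝ) :=
  if j = 0 then
    (∑ m ∈ Finset.Icc 1 k, (Ccoef k δ m * eta c0 M m) • ef (m - 1)) +
      (∑' m : ℕ, if k ≤ m then eta c0 M (m + 1) • ef m else 0) +
      (mu c0 M δ k) • ef (k - 1)
  else
    (Real.sqrt ((j : ℝ) + 1) / b) •
      ((∑ i ∈ Finset.Icc 1 k, (Acoef k δ i * eta c0 M (j + i - 1)) • ef (j + i - 2)) +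
        (mu c0 M δ (j + k - 1)) • ef (j + k - 2) -
        (mu c0 M δ (j + k)) • ef (j + k - 1))

lemma LamSpec_iff {c0 M δ b : ℝ} {k : ℕ}
    {Λ : Lp ℝ 2 (volume : Measure ℝ) →L[ℝ] Lp ℝ 2 (volume : Measure ℝ)} :
    LamSpec c0 M δ b k Λ ↔ (∀ j, Λ (ef j) = blurImage c0 M δ b k j) ∧
      (∀ v ∈ Kset, Λ v = v) ∧ (∀ z ∈ Pspace, Λ z = z) := by
  constructor
  · rintro ⟨h0, h1, hK, hP⟩
    refine ⟨fun j => ?_, hK, hP⟩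
    rcases Nat.eq_zero_or_pos j with rfl | hj
    · rw [h0, blurImage, if_pos rfl]
    · rw [h1 j hj, blurImage, if_neg hj.ne']
  · rintro ⟨h, hK, hP⟩
    refine ⟨?_, fun j hj => ?_, hK, hP⟩
    · rw [h, blurImage, if_pos rfl]
    · rw [h, blurImage, if_neg (by lia)]

lemma eta_pos {c0 M : ℝ} (hc0 : 0 < c0) (hM : 0 < M) (j : ℕ) : 0 < eta c0 M j :=
  Real.sqrt_pos.2 (by positivity)

lemma eta_antitone {c0 M : ℝ} (hc0 : 0 < c0) (hM : 1 ≤ M) : Antitone (eta c0 M) := by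
  intro i j hij
  refine Real.sqrt_le_sqrt ?_
  gcongr

lemma eta_eq {c0 M : ℝ} (hc0 : 0 < c0) (hM : 0 < M) (j : ℕ) :
    eta c0 M j = √c0 * (√M)⁻¹ ^ j := by
  have h : √(M ^ j) = √M ^ j := by
    rw [Real.sqrt_eq_iff_eq_sq (by positivity) (by positivity), ← pow_mul, mul_comm, pow_mul,
      Real.sq_sqrt hM.le]
  rw [eta, Real.sqrt_div hc0.le, h, inv_pow, div_eq_mul_inv]

lemma summable_mul_eta {c0 M : ℝ} (hc0 : 0 < c0) (hM : 1 < M) :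
    Summable fun j : ℕ => ((j : ℝ) + 1) * eta c0 M j := by
  have hr : ‖(√M)⁻¹‖ < 1 := by
    rw [norm_inv, Real.norm_of_nonneg (Real.sqrt_nonneg _)]
    exact inv_lt_one_of_one_lt₀ (Real.lt_sqrt_of_sq_lt (by simpa using hM))
  have h1 := summable_pow_mul_geometric_of_norm_lt_one 1 hr
  have h2 := summable_geometric_of_norm_lt_one hr
  refine ((h1.add h2).mul_left √c0).congr fun j => ?_
  rw [eta_eq hc0 (by linarith)]
  ring

lemma summable_eta_tail {c0 M : ℝ} (hc0 : 0 < c0) (hM : 1 < M) (k : ℕ) :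
    Summable fun m : ℕ => if k ≤ m then eta c0 M (m + 1) • ef m else 0 := by
  refine Summable.of_norm_bounded (summable_mul_eta hc0 hM) fun m => ?_
  have h0 := (eta_pos hc0 (by linarith) m : 0 < eta c0 M m)
  have hm : (0 : ℝ) ≤ m := m.cast_nonneg
  split_ifs
  · rw [norm_smul, orthonormal_ef.1 m, mul_one, Real.norm_of_nonneg (eta_pos hc0 (by linarith) _).le]
    have := eta_antitone hc0 hM.le (Nat.le_succ m)
    simp only [Nat.succ_eq_add_one] at this
    nlinarith
  · rw [norm_zero]
    positivity

lemma norm_blurImage_le {c0 M δ b : ℝ} {k : ℕ} (hk : 1 ≤ k) (hc0 : 0 < c0) (hM : 1 < M) (hb : 0 < b)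
    (hδ : 0 < δ) {j : ℕ} (hj : j ≠ 0) :
    ‖blurImage c0 M δ b k j‖ ≤
      (∑ i ∈ Finset.Icc 1 k, |Acoef k δ i| + δ + δ) / b * (((j : ℝ) + 1) * eta c0 M j) := by
  have hpos := eta_pos hc0 (show (0 : ℝ) < M by linarith)
  have hanti := eta_antitone hc0 hM.le
  have hn : ∀ (a : ℝ) (i : ℕ), ‖a • ef i‖ = |a| := fun a i => by
    rw [norm_smul, orthonormal_ef.1 i, mul_one, Real.norm_eq_abs]
  have hmu : ∀ i, j ≤ i → |mu c0 M δ i| ≤ δ * eta c0 M j := fun i hi => by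
    rw [mu, abs_mul, abs_neg, abs_of_pos hδ, abs_of_pos (hpos i)]
    gcongr
    exact hanti hi
  rw [blurImage, if_neg hj, norm_smul, Real.norm_of_nonneg (by positivity)]
  have h1 : ‖∑ i ∈ Finset.Icc 1 k, (Acoef k δ i * eta c0 M (j + i - 1)) • ef (j + i - 2)‖ ≤
      (∑ i ∈ Finset.Icc 1 k, |Acoef k δ i|) * eta c0 M j := by
    refine (norm_sum_le _ _).trans ?_
    rw [Finset.sum_mul]
    refine Finset.sum_le_sum fun i hi => ?_
    rw [hn, abs_mul, abs_of_pos (hpos _)]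
    gcongr
    refine hanti ?_
    have := (Finset.mem_Icc.1 hi).1
    lia
  have h4 : √((j : ℝ) + 1) ≤ (j : ℝ) + 1 := by
    rw [Real.sqrt_le_left (by positivity)]
    nlinarith [(j.cast_nonneg : (0 : ℝ) ≤ j)]
  have h2 : ‖(mu c0 M δ (j + k)) • ef (j + k - 1)‖ ≤ δ * eta c0 M j := by
    rw [hn]
    exact hmu _ (by lia)
  have h5 := hpos j
  have h6 : 0 ≤ ∑ i ∈ Finset.Icc 1 k, |Acoef k δ i| := Finset.sum_nonneg fun i _ => abs_nonneg _
  have h3 : ‖(mu c0 M δ (j + k - 1)) • ef (j + k - 2)‖ ≤ δ * eta c0 M j := by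
    rw [hn]
    exact hmu _ (by lia)
  calc _ ≤ ((j : ℝ) + 1) / b * ((∑ i ∈ Finset.Icc 1 k, |Acoef k δ i|) * eta c0 M j +
        δ * eta c0 M j + δ * eta c0 M j) := by
        gcongr
        exact (norm_sub_le _ _).trans (add_le_add ((norm_add_le _ _).trans (add_le_add h1 h3)) h2)
    _ = _ := by ring

lemma summable_norm_blurImage {c0 M δ b : ℝ} {k : ℕ} (hk : 1 ≤ k) (hc0 : 0 < c0) (hM : 1 < M)
    (hb : 0 < b) (hδ : 0 < δ) : Summable fun j => ‖blurImage c0 M δ b k j‖ := by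
  rw [← summable_nat_add_iff 1]
  refine Summable.of_nonneg_of_le (fun _ => norm_nonneg _)
    (fun j => norm_blurImage_le hk hc0 hM hb hδ j.succ_ne_zero) ?_
  exact (summable_nat_add_iff 1).2 ((summable_mul_eta hc0 hM).mul_left _)

lemma exists_LamSpec {c0 M δ b : ℝ} {k : ℕ} (hk : 1 ≤ k) (hc0 : 0 < c0) (hM : 1 < M)
    (hb : 0 < b) (hδ : 0 < δ) :
    ∃ Λ : Lp ℝ 2 (volume : Measure ℝ) →L[ℝ] Lp ℝ 2 (volume : Measure ℝ),
      LamSpec c0 M δ b k Λ := by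
  set S : ℕ → Lp ℝ 2 (volume : Measure ℝ) →L[ℝ] Lp ℝ 2 (volume : Measure ℝ) :=
    fun j => (innerSL ℝ (ef j)).smulRight (blurImage c0 M δ b k j) with hS
  have hsum : Summable S := by
    refine Summable.of_norm_bounded (summable_norm_blurImage hk hc0 hM hb hδ) fun j => ?_
    simp [hS, orthonormal_ef.1 j]
  have hval : ∀ x, HasSum (fun j => (inner ℝ (ef j) x) • blurImage c0 M δ b k j) ((∑' j, S j) x) :=
    fun x => hsum.hasSum.mapL (ContinuousLinearMap.apply ℝ _ x)
  have horth : ∀ x ∈ Htildeᗮ,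
      (ContinuousLinearMap.id ℝ (Lp ℝ 2 (volume : Measure ℝ)) - Htilde.starProjection +
        ∑' j, S j) x = x := by
    intro x hx
    have h1 : (∑' j, S j) x = 0 := by
      refine (hval x).unique ?_
      simp [mem_Htilde_orthogonal_iff.1 hx, hasSum_zero]
    have h2 : Htilde.starProjection x = 0 := (Submodule.starProjection_apply_eq_zero_iff Htilde).2 hx
    simp [h1, h2]
  refine ⟨ContinuousLinearMap.id ℝ _ - Htilde.starProjection + ∑' j, S j, LamSpec_iff.2
    ⟨fun j => ?_, fun v hv => horth v (Kset_subset_orthogonal hv), fun z hz => ?_⟩⟩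
  · have h1 : (∑' i, S i) (ef j) = blurImage c0 M δ b k j := by
      refine (hval (ef j)).unique ?_
      convert hasSum_single j ?_ using 1
      · simp [orthonormal_ef.1 j]
      · intro i hi
        simp [orthonormal_ef.2 hi]
    have h2 : Htilde.starProjection (ef j) = ef j :=
      Submodule.starProjection_eq_self_iff.2 (ef_mem_Htilde j)
    simp [h1, h2]
  · exact horth z (Submodule.orthogonal_le le_sup_left hz)

lemma blurImage_mem_Htilde {c0 M δ b : ℝ} {k : ℕ} (hc0 : 0 < c0) (hM : 1 < M) (j : ℕ) :
    blurImage c0 M δ b k j ∈ Htilde := by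
  have he := fun (a : ℝ) i => Htilde.smul_mem a (ef_mem_Htilde i)
  rw [blurImage]
  split_ifs
  · refine Htilde.add_mem (Htilde.add_mem (Htilde.sum_mem fun _ _ => he _ _) ?_) (he _ _)
    refine (Submodule.isClosed_topologicalClosure _).mem_of_tendsto
      (summable_eta_tail hc0 hM k).hasSum (Eventually.of_forall fun s => ?_)
    refine Htilde.sum_mem fun m _ => ?_
    split_ifs
    · exact he _ _
    · exact Htilde.zero_mem
  · exact Htilde.smul_mem _ (Htilde.sub_mem (Htilde.add_mem (Htilde.sum_mem fun _ _ => he _ _)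
      (he _ _)) (he _ _))

lemma LamSpec.map_mem_Htilde {c0 M δ b : ℝ} {k : ℕ}
    {Λ : Lp ℝ 2 (volume : Measure ℝ) →L[ℝ] Lp ℝ 2 (volume : Measure ℝ)}
    (hΛ : LamSpec c0 M δ b k Λ) (hc0 : 0 < c0) (hM : 1 < M)
    {x : Lp ℝ 2 (volume : Measure ℝ)} (hx : x ∈ Htilde) : Λ x ∈ Htilde := by
  refine (Submodule.isClosed_topologicalClosure _).mem_of_tendsto
    ((orthonormal_ef.hasSum_inner_smul_of_mem_closure hx).mapL Λ) (Eventually.of_forall fun s => ?_)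
  refine Htilde.sum_mem fun j _ => ?_
  rw [map_smul, (LamSpec_iff.1 hΛ).1 j]
  exact Htilde.smul_mem _ (blurImage_mem_Htilde hc0 hM j)

lemma LamSpec.apply_of_mem_orthogonal {c0 M δ b : ℝ} {k : ℕ}
    {Λ : Lp ℝ 2 (volume : Measure ℝ) →L[ℝ] Lp ℝ 2 (volume : Measure ℝ)}
    (hΛ : LamSpec c0 M δ b k Λ) {q : Lp ℝ 2 (volume : Measure ℝ)} (hq : q ∈ Htildeᗮ) :
    Λ q = q := by
  obtain ⟨-, hK, hP⟩ := LamSpec_iff.1 hΛ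
  set Q := ContinuousLinearMap.id ℝ (Lp ℝ 2 (volume : Measure ℝ)) - Htilde.starProjection with hQ
  have hQq : ∀ x ∈ Htildeᗮ, Q x = x := fun x hx => by
    simp [hQ, (Submodule.starProjection_apply_eq_zero_iff Htilde).2 hx]
  set Φ := Λ ∘L Q - Q with hΦ
  have hS : (Htilde ⊔ Submodule.span ℝ Kset).topologicalClosure ≤ Φ.ker := by
    refine Submodule.topologicalClosure_minimal _ (sup_le ?_ (Submodule.span_le.2 ?_))
      Φ.isClosed_ker
    · intro x hx
      have : Q x = 0 := by simp [hQ, Submodule.starProjection_eq_self_iff.2 hx]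
      simp [hΦ, this]
    · intro v hv
      simp [hΦ, hQq v (Kset_subset_orthogonal hv), hK v hv]
  have : CompleteSpace (Htilde ⊔ Submodule.span ℝ Kset).topologicalClosure :=
    (Submodule.isClosed_topologicalClosure _).completeSpace_coe
  obtain ⟨s, hs, z, hz, rfl⟩ :=
    (Htilde ⊔ Submodule.span ℝ Kset).topologicalClosure.exists_add_mem_mem_orthogonal q
  rw [Submodule.orthogonal_closure] at hz
  have h1 : Φ s = 0 := hS hs
  have h2 : Φ z = 0 := by
    have hz' : z ∈ Htildeᗮ := Submodule.orthogonal_le le_sup_left hz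
    simp [hΦ, hQq z hz', hP z hz]
  have h3 : Φ (s + z) = 0 := by rw [map_add, h1, h2, add_zero]
  simp only [hΦ, sub_apply, ContinuousLinearMap.comp_apply, hQq _ hq] at h3
  exact sub_eq_zero.1 h3

lemma LamSpec.sub_starProjection_apply {c0 M δ b : ℝ} {k : ℕ}
    {Λ : Lp ℝ 2 (volume : Measure ℝ) →L[ℝ] Lp ℝ 2 (volume : Measure ℝ)}
    (hΛ : LamSpec c0 M δ b k Λ) (hc0 : 0 < c0) (hM : 1 < M) (w : Lp ℝ 2 (volume : Measure ℝ)) :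
    Λ w - Htilde.starProjection (Λ w) = w - Htilde.starProjection w := by
  have h1 := hΛ.map_mem_Htilde hc0 hM (Htilde.starProjection_apply_mem w)
  have h2 := hΛ.apply_of_mem_orthogonal (Htilde.sub_starProjection_mem_orthogonal w)
  have h3 : Λ w = Λ (Htilde.starProjection w) + (w - Htilde.starProjection w) := by
    rw [← h2, ← map_add]
    simp
  have h4 : Htilde.starProjection (w - Htilde.starProjection w) = 0 :=
    (Submodule.starProjection_apply_eq_zero_iff Htilde).2 (Htilde.sub_starProjection_mem_orthogonal w)
  rw [h3, map_add, Submodule.starProjection_eq_self_iff.2 h1, h4]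
  abel

lemma eq_zero_of_toeplitz {β a : ℕ → ℝ} (hβ : β 0 ≠ 0)
    (h : ∀ n, ∑ j ∈ Finset.range (n + 1), β (n - j) * a j = 0) (n : ℕ) : a n = 0 := by
  induction n using Nat.strong_induction_on with
  | _ n ih =>
    have hn := h n
    rw [Finset.sum_range_succ, Finset.sum_eq_zero fun j hj => by
      rw [ih j (Finset.mem_range.1 hj), mul_zero], zero_add, Nat.sub_self] at hn
    exact (mul_eq_zero.1 hn).resolve_left hβ

lemma sum_toeplitzCoef (k : ℕ) (δ : ℝ) (n : ℕ) :
    ∑ p ∈ Finset.range (n + 1), toeplitzCoef k δ p =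
      if n ≤ k then 1 - k * δ + n * δ else 1 := by
  induction n with
  | zero => simp [toeplitzCoef]
  | succ n ih =>
    rw [Finset.sum_range_succ, ih, toeplitzCoef, if_neg n.succ_ne_zero]
    rcases lt_trichotomy n k with h | rfl | h
    · rw [if_pos h.le, if_pos (by lia), if_pos (by lia)]
      push_cast
      ring
    · rw [if_pos le_rfl, if_neg (by lia), if_neg (by lia)]
      ring
    · rw [if_neg (by lia), if_neg (by lia), if_neg (by lia), add_zero]

lemma Ccoef_succ_eq {k : ℕ} (hk : 2 ≤ k) (δ : ℝ) {n : ℕ} (hn : n + 1 ≤ k) :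
    Ccoef k δ (n + 1) = 1 - k * δ + n * δ + if n + 1 = k then δ else 0 := by
  induction n with
  | zero =>
    have : 0 + 1 ≠ k := by lia
    simp [Ccoef, Acoef, this]
  | succ n ih =>
    have h := ih (by lia)
    rw [Ccoef] at h ⊢
    rw [Finset.sum_Icc_succ_top (by lia), h, Acoef, if_neg (by lia : n + 1 ≠ k),
      if_neg (by lia : n + 1 + 1 ≠ 1)]
    split_ifs <;> push_cast <;> ring

lemma inner_ef_ef (n m : ℕ) : inner ℝ (ef n) (ef m) = if n = m then (1 : ℝ) else 0 :=
  orthonormal_iff_ite.1 orthonormal_ef n m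

lemma inner_ef_blurImage_zero {c0 M δ b : ℝ} {k : ℕ} (hk : 2 ≤ k) (hc0 : 0 < c0) (hM : 1 < M)
    (n : ℕ) : inner ℝ (ef n) (blurImage c0 M δ b k 0) =
      eta c0 M (n + 1) * ∑ p ∈ Finset.range (n + 1), toeplitzCoef k δ p := by
  have htail : inner ℝ (ef n) (∑' m : ℕ, if k ≤ m then eta c0 M (m + 1) • ef m else 0) =
      if k ≤ n then eta c0 M (n + 1) else 0 := by
    have h1 := (summable_eta_tail hc0 hM k).hasSum.mapL (innerSL ℝ (ef n))
    refine h1.unique ?_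
    convert hasSum_single n ?_ using 1
    · split_ifs <;> simp [orthonormal_ef.1 n]
    · intro m hm
      split_ifs <;> simp [inner_ef_ef, hm.symm]
  have hsum : inner ℝ (ef n) (∑ m ∈ Finset.Icc 1 k, (Ccoef k δ m * eta c0 M m) • ef (m - 1)) =
      if n + 1 ≤ k then Ccoef k δ (n + 1) * eta c0 M (n + 1) else 0 := by
    rw [inner_sum]
    calc _ = ∑ m ∈ Finset.Icc 1 k, if n + 1 = m then Ccoef k δ m * eta c0 M m else 0 := by
          refine Finset.sum_congr rfl fun m hm => ?_
          have := (Finset.mem_Icc.1 hm).1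
          rw [real_inner_smul_right, inner_ef_ef, mul_ite, mul_one, mul_zero]
          exact if_congr (by lia) rfl rfl
      _ = _ := by
          rw [Finset.sum_ite_eq]
          exact if_congr (by rw [Finset.mem_Icc]; lia) rfl rfl
  rw [blurImage, if_pos rfl, inner_add_right, inner_add_right, hsum, htail, real_inner_smul_right,
    inner_ef_ef, sum_toeplitzCoef, mu]
  rcases lt_trichotomy (n + 1) k with h | h | h
  · rw [if_pos h.le, Ccoef_succ_eq hk δ h.le, if_neg h.ne, if_neg (by lia), if_neg (by lia),
      if_pos (by lia)]
    ring
  · rw [if_pos h.le, Ccoef_succ_eq hk δ h.le, if_pos h, if_neg (by lia), if_pos (by lia),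
      if_pos (by lia), ← h]
    ring
  · rw [if_neg (by lia), if_pos (by lia), if_neg (by lia)]
    split_ifs with h1
    · obtain rfl : n = k := by lia
      ring
    · ring

lemma inner_ef_blurImage_of_lt {c0 M δ b : ℝ} {k : ℕ} (hk : 2 ≤ k) {n j : ℕ} (hj : n + 1 < j) :
    inner ℝ (ef n) (blurImage c0 M δ b k j) = 0 := by
  rw [blurImage, if_neg (by lia), real_inner_smul_right, inner_sub_right, inner_add_right, inner_sum,
    Finset.sum_eq_zero fun i hi => ?_]
  · rw [real_inner_smul_right, real_inner_smul_right, inner_ef_ef, inner_ef_ef, if_neg (by lia),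
      if_neg (by lia)]
    ring
  · have := (Finset.mem_Icc.1 hi).1
    rw [real_inner_smul_right, inner_ef_ef, if_neg (by lia), mul_zero]

lemma inner_ef_blurImage_succ {c0 M δ b : ℝ} {k : ℕ} (hk : 2 ≤ k) {n j : ℕ} (hj : j ≤ n) :
    inner ℝ (ef n) (blurImage c0 M δ b k (j + 1)) =
      √((j : ℝ) + 1 + 1) / b * (eta c0 M (n + 1) * toeplitzCoef k δ (n - j)) := by
  obtain ⟨p, rfl⟩ := Nat.exists_eq_add_of_le hj
  have hsum : inner ℝ (ef (j + p)) (∑ i ∈ Finset.Icc 1 k,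
      (Acoef k δ i * eta c0 M (j + 1 + i - 1)) • ef (j + 1 + i - 2)) =
      if p + 1 ≤ k then Acoef k δ (p + 1) * eta c0 M (j + p + 1) else 0 := by
    rw [inner_sum]
    calc _ = ∑ i ∈ Finset.Icc 1 k, if p + 1 = i then
          Acoef k δ i * eta c0 M (j + 1 + i - 1) else 0 := by
          refine Finset.sum_congr rfl fun i hi => ?_
          have := (Finset.mem_Icc.1 hi).1
          rw [real_inner_smul_right, inner_ef_ef, mul_ite, mul_one, mul_zero]
          exact if_congr (by lia) rfl rfl
      _ = _ := by
          rw [Finset.sum_ite_eq, show j + 1 + (p + 1) - 1 = j + p + 1 by lia]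
          exact if_congr (by rw [Finset.mem_Icc]; lia) rfl rfl
  rw [blurImage, if_neg j.succ_ne_zero, real_inner_smul_right, inner_sub_right, inner_add_right,
    hsum, real_inner_smul_right, real_inner_smul_right, inner_ef_ef, inner_ef_ef,
    Nat.add_sub_cancel_left, Nat.cast_add, Nat.cast_one, toeplitzCoef, Acoef, mu, mu]
  congr 1
  rcases Nat.eq_zero_or_pos p with rfl | hp
  · rw [if_pos (by lia), if_pos rfl, if_neg (by lia), if_neg (by lia), if_pos rfl, add_zero]
    ring
  rw [if_neg (by lia : p + 1 ≠ 1), if_neg hp.ne']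
  rcases lt_trichotomy (p + 1) k with h | h | h
  · rw [if_pos h.le, if_neg h.ne, if_neg (by lia), if_neg (by lia), if_pos (by lia)]
    ring
  · rw [if_pos h.le, if_pos h, if_pos (by lia), if_neg (by lia), if_pos (by lia),
      show j + 1 + k - 1 = j + p + 1 by lia]
    ring
  · rw [if_neg (by lia), if_neg (by lia)]
    split_ifs with h1 h2 h2
    · rw [show j + 1 + k = j + p + 1 by lia]
      ring
    · lia
    · lia
    · ring

lemma LamSpec.injective {c0 M δ b : ℝ} {k : ℕ}
    {Λ : Lp ℝ 2 (volume : Measure ℝ) →L[ℝ] Lp ℝ 2 (volume : Measure ℝ)}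
    (hΛ : LamSpec c0 M δ b k Λ) (hk : 2 ≤ k) (hc0 : 0 < c0) (hM : 1 < M) (hb : 0 < b)
    (hδ : δ < 1 / k) : Function.Injective Λ := by
  rw [injective_iff_map_eq_zero]
  intro w hw
  have hwH : w ∈ Htilde := by
    have h := hΛ.sub_starProjection_apply hc0 hM w
    rw [hw, map_zero, sub_zero, eq_comm, sub_eq_zero] at h
    exact Submodule.starProjection_eq_self_iff.1 h.symm
  set γ : ℕ → ℝ := fun j => inner ℝ (ef j) w with hγ
  have hsum := orthonormal_ef.hasSum_inner_smul_of_mem_closure hwH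
  have hcoord : ∀ n, ∑ j ∈ Finset.range (n + 2),
      γ j * inner ℝ (ef n) (blurImage c0 M δ b k j) = 0 := by
    intro n
    have h1 := (hsum.mapL Λ).mapL (innerSL ℝ (ef n))
    rw [hw, map_zero] at h1
    refine (hasSum_sum_of_ne_finset_zero ?_).unique (h1.congr_fun ?_)
    · intro j hj
      rw [inner_ef_blurImage_of_lt hk (by rw [Finset.mem_range] at hj; lia), mul_zero]
    · intro j
      simp [hγ, (LamSpec_iff.1 hΛ).1]
  have hcoef : toeplitzCoef k δ 0 ≠ 0 := by
    have hk0 : (0 : ℝ) < k := by exact_mod_cast (by lia : 0 < k)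
    rw [lt_div_iff₀ hk0] at hδ
    rw [toeplitzCoef, if_pos rfl]
    linarith
  have hzero := eq_zero_of_toeplitz (β := toeplitzCoef k δ)
    (a := fun j => γ (j + 1) * (√((j : ℝ) + 1 + 1) / b) + γ 0) hcoef (fun n => by
      have h1 := hcoord n
      rw [Finset.sum_range_succ', inner_ef_blurImage_zero hk hc0 hM,
        ← Finset.sum_range_reflect (toeplitzCoef k δ), Finset.mul_sum, Finset.mul_sum, ← Finset.sum_add_distrib] at h1
      refine (mul_eq_zero.1 ?_).resolve_left (eta_pos hc0 (by linarith : 0 < M) (n + 1)).ne'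
      rw [Finset.mul_sum, ← h1]
      refine Finset.sum_congr rfl fun j hj => ?_
      rw [inner_ef_blurImage_succ hk (by rw [Finset.mem_range] at hj; lia),
        show n + 1 - 1 - j = n - j by lia]
      ring)
  have hγ0 : γ 0 = 0 := by
    by_contra hne
    have hs : Summable fun j => γ j ^ 2 := by
      simpa using orthonormal_ef.inner_products_summable w
    have hs1 := ((summable_nat_add_iff 1).2 hs).mul_left ((b * γ 0) ^ 2)⁻¹
    have hs2 : Summable fun j : ℕ => (((j + 2 : ℕ) : ℝ))⁻¹ := by
      refine hs1.congr fun j => ?_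
      have h1 := hzero j
      have h2 : √((j : ℝ) + 1 + 1) ^ 2 = j + 1 + 1 := Real.sq_sqrt (by positivity)
      have h3 : γ (j + 1) * √((j : ℝ) + 1 + 1) = -(b * γ 0) := by
        field_simp at h1
        linarith
      have h4 : γ (j + 1) ^ 2 * ((j : ℝ) + 1 + 1) = (b * γ 0) ^ 2 := by
        rw [← h2, ← mul_pow, h3, neg_sq]
      rw [← h4]
      have h5 : γ (j + 1) ≠ 0 := by
        intro h0
        rw [h0, zero_mul, eq_comm, neg_eq_zero] at h3
        exact (mul_ne_zero hb.ne' hne) h3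
      push_cast
      field_simp
      ring
    exact Real.not_summable_natCast_inv ((summable_nat_add_iff 2).1 hs2)
  have hall : ∀ j, γ j = 0 := by
    rintro (_ | j)
    · exact hγ0
    · have h1 := hzero j
      simp only [hγ0, add_zero] at h1
      exact (mul_eq_zero.1 h1).resolve_right (by positivity)
  refine hsum.unique ?_
  have : ∀ j, (inner ℝ (ef j) w : ℝ) = 0 := hall
  simp [this, hasSum_zero]

/-- The functional minimized in the deblurring problem. -/
def deblurEnergy (Λ : Lp ℝ 2 (volume : Measure ℝ) →L[ℝ] Lp ℝ 2 (volume : Measure ℝ)) (lam : ℝ)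
    (Λt w : Lp ℝ 2 (volume : Measure ℝ)) : ℝ≥0∞ :=
  ENNReal.ofReal (lam * ‖Λt - Λ w‖ ^ 2) + BVnorm w

lemma deblurEnergy_midpoint_le
    (Λ : Lp ℝ 2 (volume : Measure ℝ) →L[ℝ] Lp ℝ 2 (volume : Measure ℝ)) {lam : ℝ} (hlam : 0 < lam)
    (Λt u v : Lp ℝ 2 (volume : Measure ℝ)) :
    deblurEnergy Λ lam Λt ((1 / 2 : ℝ) • (u + v)) + ENNReal.ofReal (lam / 4 * ‖Λ u - Λ v‖ ^ 2) ≤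
      (deblurEnergy Λ lam Λt u + deblurEnergy Λ lam Λt v) / 2 := by
  have hpar : lam * ‖Λt - Λ ((1 / 2 : ℝ) • (u + v))‖ ^ 2 + lam / 4 * ‖Λ u - Λ v‖ ^ 2 =
      (lam * ‖Λt - Λ u‖ ^ 2 + lam * ‖Λt - Λ v‖ ^ 2) / 2 := by
    have h := parallelogram_law_with_norm ℝ (Λt - Λ u) (Λt - Λ v)
    have h1 : Λt - Λ u + (Λt - Λ v) = (2 : ℝ) • (Λt - Λ ((1 / 2 : ℝ) • (u + v))) := by
      rw [map_smul, map_add]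
      module
    have h2 : Λt - Λ u - (Λt - Λ v) = -(Λ u - Λ v) := by abel
    rw [h1, h2, norm_neg, norm_smul, Real.norm_of_nonneg two_pos.le] at h
    linear_combination lam / 4 * h
  calc _ = ENNReal.ofReal (lam * ‖Λt - Λ ((1 / 2 : ℝ) • (u + v))‖ ^ 2 +
        lam / 4 * ‖Λ u - Λ v‖ ^ 2) + BVnorm ((1 / 2 : ℝ) • (u + v)) := by
        rw [deblurEnergy, ENNReal.ofReal_add (by positivity) (by positivity)]
        ring
    _ ≤ (ENNReal.ofReal (lam * ‖Λt - Λ u‖ ^ 2) + ENNReal.ofReal (lam * ‖Λt - Λ v‖ ^ 2)) / 2 +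
        (BVnorm u + BVnorm v) / 2 := by
        gcongr
        · rw [hpar, ENNReal.ofReal_div_of_pos two_pos, ENNReal.ofReal_add (by positivity)
            (by positivity), ENNReal.ofReal_ofNat]
        · exact BVnorm_midpoint_le u v
    _ = _ := by
        rw [← ENNReal.add_div, deblurEnergy, deblurEnergy]
        congr 1
        ring

lemma ofReal_norm_sub_sq_le_of_energy_le
    (Λ : Lp ℝ 2 (volume : Measure ℝ) →L[ℝ] Lp ℝ 2 (volume : Measure ℝ)) {lam : ℝ} (hlam : 0 < lam)
    {Λt u v : Lp ℝ 2 (volume : Measure ℝ)} {m ε : ℝ≥0∞} (hm : m ≠ ⊤)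
    (hmin : ∀ w, m ≤ deblurEnergy Λ lam Λt w) (hu : deblurEnergy Λ lam Λt u ≤ m + ε)
    (hv : deblurEnergy Λ lam Λt v ≤ m + ε) :
    ENNReal.ofReal (lam / 4 * ‖Λ u - Λ v‖ ^ 2) ≤ ε := by
  have h1 : m + ENNReal.ofReal (lam / 4 * ‖Λ u - Λ v‖ ^ 2) ≤ m + ε := by
    calc _ ≤ deblurEnergy Λ lam Λt ((1 / 2 : ℝ) • (u + v)) +
          ENNReal.ofReal (lam / 4 * ‖Λ u - Λ v‖ ^ 2) := by
          gcongr
          exact hmin _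
      _ ≤ _ := deblurEnergy_midpoint_le Λ hlam Λt u v
      _ ≤ ((m + ε) + (m + ε)) / 2 := by gcongr
      _ = m + ε := by rw [ENNReal.add_div, ENNReal.add_halves]
  exact (ENNReal.add_le_add_iff_left hm).1 h1

/-- The energy is lower semicontinuous along convergent sequences. -/
lemma deblurEnergy_le_of_tendsto
    (Λ : Lp ℝ 2 (volume : Measure ℝ) →L[ℝ] Lp ℝ 2 (volume : Measure ℝ)) {lam : ℝ}
    {Λt y : Lp ℝ 2 (volume : Measure ℝ)} {w : ℕ → Lp ℝ 2 (volume : Measure ℝ)} {m : ℝ≥0∞}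
    (hw : Tendsto w atTop (𝓝 y))
    (hm : Tendsto (fun n => deblurEnergy Λ lam Λt (w n)) atTop (𝓝 m)) :
    deblurEnergy Λ lam Λt y ≤ m := by
  have hA : Tendsto (fun n => ENNReal.ofReal (lam * ‖Λt - Λ (w n)‖ ^ 2)) atTop
      (𝓝 (ENNReal.ofReal (lam * ‖Λt - Λ y‖ ^ 2))) := by
    refine ENNReal.tendsto_ofReal ?_
    exact ((((Λ.continuous.tendsto y).comp hw).const_sub Λt).norm.pow 2).const_mul lam
  have hAm : ENNReal.ofReal (lam * ‖Λt - Λ y‖ ^ 2) ≤ m :=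
    le_of_tendsto_of_tendsto' hA hm fun n => le_self_add
  have hsub := ENNReal.Tendsto.sub hm hA (Or.inr ENNReal.ofReal_ne_top)
  have hBV : BVnorm y ≤ m - ENNReal.ofReal (lam * ‖Λt - Λ y‖ ^ 2) := by
    refine le_of_forall_gt_imp_ge_of_dense fun c hc => BVnorm_le_of_tendsto hw ?_
    filter_upwards [hsub.eventually_lt_const hc] with n hn
    refine le_trans ?_ hn.le
    exact ENNReal.le_sub_of_add_le_left ENNReal.ofReal_ne_top le_rfl
  calc _ ≤ ENNReal.ofReal (lam * ‖Λt - Λ y‖ ^ 2) +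
        (m - ENNReal.ofReal (lam * ‖Λt - Λ y‖ ^ 2)) := by
        rw [deblurEnergy]
        gcongr
    _ = m := add_tsub_cancel_of_le hAm

/-- A sequence with bounded total variation whose blurred images converge has a convergent
subsequence. -/
lemma LamSpec.exists_tendsto_subseq {c0 M δ b : ℝ} {k : ℕ}
    {Λ : Lp ℝ 2 (volume : Measure ℝ) →L[ℝ] Lp ℝ 2 (volume : Measure ℝ)}
    (hΛ : LamSpec c0 M δ b k Λ) (hc0 : 0 < c0) (hM : 1 < M)
    {w : ℕ → Lp ℝ 2 (volume : Measure ℝ)} {C : ℝ} (hC : 0 ≤ C)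
    (hBV : ∀ n, BVnorm (w n) < ENNReal.ofReal C) (hcauchy : CauchySeq fun n => Λ (w n)) :
    ∃ (y : Lp ℝ 2 (volume : Measure ℝ)) (φ : ℕ → ℕ), StrictMono φ ∧
      Tendsto (w ∘ φ) atTop (𝓝 y) := by
  obtain ⟨ℓ, hℓ⟩ := cauchySeq_tendsto_of_complete hcauchy
  have hq : Tendsto (fun n => w n - Htilde.starProjection (w n)) atTop
      (𝓝 (ℓ - Htilde.starProjection ℓ)) := by
    refine (hℓ.sub ((Htilde.starProjection.continuous.tendsto ℓ).comp hℓ)).congr fun n => ?_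
    exact hΛ.sub_starProjection_apply hc0 hM (w n)
  obtain ⟨D, hD⟩ := hq.norm.bddAbove_range
  have hD' : ∀ n, ‖w n - Htilde.starProjection (w n)‖ ≤ D := fun n => hD ⟨n, rfl⟩
  have hinner : ∀ j n, inner ℝ (ef j) (Htilde.starProjection (w n)) = inner ℝ (ef j) (w n) := by
    intro j n
    have h := (Submodule.mem_orthogonal _ _).1
      (Htilde.sub_starProjection_mem_orthogonal (w n)) _ (ef_mem_Htilde j)
    rw [inner_sub_right, sub_eq_zero] at h
    exact h.symm
  obtain ⟨p, φ, hφ, hp⟩ := orthonormal_ef.exists_tendsto_subseq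
    (x := fun n => Htilde.starProjection (w n)) (R := 8 * (D ^ 2 + C ^ 2))
    (fun n => Htilde.starProjection_apply_mem (w n)) (fun n N => by
      simp only [hinner]
      exact sum_mul_inner_ef_sq_le hC (hBV n) (hD' n) N)
  refine ⟨p + (ℓ - Htilde.starProjection ℓ), φ, hφ, ?_⟩
  refine (hp.add (hq.comp hφ.tendsto_atTop)).congr fun n => ?_
  simp

lemma LamSpec.exists_minimizer {c0 M δ b : ℝ} {k : ℕ}
    {Λ : Lp ℝ 2 (volume : Measure ℝ) →L[ℝ] Lp ℝ 2 (volume : Measure ℝ)}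
    (hΛ : LamSpec c0 M δ b k Λ) (hc0 : 0 < c0) (hM : 1 < M) {lam : ℝ} (hlam : 0 < lam)
    (Λt : Lp ℝ 2 (volume : Measure ℝ)) :
    ∃ y, ∀ w, deblurEnergy Λ lam Λt y ≤ deblurEnergy Λ lam Λt w := by
  set m := ⨅ w, deblurEnergy Λ lam Λt w with hm
  have hmle : ∀ w, m ≤ deblurEnergy Λ lam Λt w := fun w => iInf_le _ w
  have hmtop : m ≠ ⊤ := by
    refine ne_top_of_le_ne_top ?_ (hmle 0)
    rw [deblurEnergy, BVnorm_zero, add_zero]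
    exact ENNReal.ofReal_ne_top
  set ε : ℕ → ℝ := fun n => 1 / ((n : ℝ) + 1) with hε
  have hεpos : ∀ n, 0 < ε n := fun n => by positivity
  have hε0 : Tendsto ε atTop (𝓝 0) := tendsto_one_div_add_atTop_nhds_zero_nat
  have hεanti : ∀ i j, i ≤ j → ε j ≤ ε i := fun i j hij => by
    simp only [hε]
    gcongr
  have hex : ∀ n, ∃ w, deblurEnergy Λ lam Λt w < m + ENNReal.ofReal (ε n) := fun n =>
    iInf_lt_iff.1 (ENNReal.lt_add_right hmtop (ENNReal.ofReal_pos.2 (hεpos n)).ne')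
  choose w hw using hex
  have hcauchy : CauchySeq fun n => Λ (w n) := by
    refine cauchySeq_of_le_tendsto_0 (fun n => √(4 / lam * ε n)) ?_ ?_
    · intro i j N hi hj
      have hle : ∀ i, N ≤ i → deblurEnergy Λ lam Λt (w i) ≤ m + ENNReal.ofReal (ε N) := fun i hi =>
        (hw i).le.trans (by gcongr; exact hεanti _ _ hi)
      have h := ofReal_norm_sub_sq_le_of_energy_le Λ hlam hmtop hmle (hle i hi) (hle j hj)
      rw [ENNReal.ofReal_le_ofReal_iff (hεpos N).le] at h
      rw [dist_eq_norm]
      refine Real.le_sqrt_of_sq_le ?_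
      rw [div_mul_eq_mul_div, le_div_iff₀ hlam]
      linarith
    · have := ((hε0.const_mul (4 / lam)).sqrt)
      simpa using this
  have hBV : ∀ n, BVnorm (w n) < ENNReal.ofReal (m.toReal + 1) := by
    intro n
    calc BVnorm (w n) ≤ deblurEnergy Λ lam Λt (w n) := le_add_self
      _ < m + ENNReal.ofReal (ε n) := hw n
      _ ≤ m + ENNReal.ofReal 1 := by
          gcongr
          simpa [hε] using hεanti 0 n n.zero_le
      _ = _ := by
          rw [ENNReal.ofReal_add ENNReal.toReal_nonneg zero_le_one, ENNReal.ofReal_toReal hmtop]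
  obtain ⟨y, φ, hφ, hy⟩ := hΛ.exists_tendsto_subseq hc0 hM
    (add_nonneg ENNReal.toReal_nonneg zero_le_one) hBV hcauchy
  have hlim : Tendsto (fun n => deblurEnergy Λ lam Λt (w n)) atTop (𝓝 m) := by
    refine tendsto_of_tendsto_of_tendsto_of_le_of_le tendsto_const_nhds ?_ (fun n => hmle _)
      (fun n => (hw n).le)
    simpa using tendsto_const_nhds.add (ENNReal.tendsto_ofReal hε0)
  exact ⟨y, fun v => (deblurEnergy_le_of_tendsto Λ hy (hlim.comp hφ.tendsto_atTop)).trans (hmle v)⟩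

lemma minimizer_unique
    {Λ : Lp ℝ 2 (volume : Measure ℝ) →L[ℝ] Lp ℝ 2 (volume : Measure ℝ)}
    (hΛ : Function.Injective Λ) {lam : ℝ} (hlam : 0 < lam) {Λt y y' : Lp ℝ 2 (volume : Measure ℝ)}
    (hy : ∀ w, deblurEnergy Λ lam Λt y ≤ deblurEnergy Λ lam Λt w)
    (hy' : ∀ w, deblurEnergy Λ lam Λt y' ≤ deblurEnergy Λ lam Λt w) : y' = y := by
  have htop : deblurEnergy Λ lam Λt y ≠ ⊤ := by
    refine ne_top_of_le_ne_top ?_ (hy 0)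
    rw [deblurEnergy, BVnorm_zero, add_zero]
    exact ENNReal.ofReal_ne_top
  have h := ofReal_norm_sub_sq_le_of_energy_le Λ hlam (ε := 0) htop hy
    ((hy' y).trans le_self_add) le_self_add
  rw [nonpos_iff_eq_zero, ENNReal.ofReal_eq_zero] at h
  have h1 : ‖Λ y' - Λ y‖ ^ 2 ≤ 0 := nonpos_of_mul_nonpos_right h (by positivity)
  have h2 : ‖Λ y' - Λ y‖ = 0 := by nlinarith [norm_nonneg (Λ y' - Λ y)]
  exact hΛ (sub_eq_zero.1 (norm_eq_zero.1 h2))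

/-- Lemma 4.10.  The operator `Λ` is a well-defined bounded linear
injective operator on `L²(ℝ)`, and for every `λ > 0` and every datum `Λ̃ ∈ L²(ℝ)` the
problem  `min { λ‖Λ̃ − Λ w‖² + ‖w‖_{BV(ℝ)} : w ∈ L²(ℝ) }` has a unique solution. -/
theorem statement18 (M α0 c0 b δ : ℝ) (k : ℕ) (hM : 2 ≤ M) (hα0 : 0 < α0)
    (hk : 3 ≤ k) (hc0 : 0 < c0) (hb : 0 < b) (hδ0 : 0 < δ) (hδ1 : δ < 1 / k) :
    (∃ Λ : Lp ℝ 2 (volume : Measure ℝ) →L[ℝ] Lp ℝ 2 (volume : Measure ℝ),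
      LamSpec c0 M δ b k Λ) ∧
    ∀ Λ : Lp ℝ 2 (volume : Measure ℝ) →L[ℝ] Lp ℝ 2 (volume : Measure ℝ),
      LamSpec c0 M δ b k Λ →
      Function.Injective Λ ∧
      ∀ lam : ℝ, 0 < lam → ∀ Λt : Lp ℝ 2 (volume : Measure ℝ),
        ∃! wmin : Lp ℝ 2 (volume : Measure ℝ),
          ∀ w : Lp ℝ 2 (volume : Measure ℝ),
            ENNReal.ofReal (lam * ‖Λt - Λ wmin‖ ^ 2) + BVnorm wmin ≤
              ENNReal.ofReal (lam * ‖Λt - Λ w‖ ^ 2) + BVnorm w := by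
  have hM1 : 1 < M := by linarith
  refine ⟨exists_LamSpec (by lia) hc0 hM1 hb hδ0, fun Λ hΛ => ?_⟩
  have hinj := hΛ.injective (by lia) hc0 hM1 hb hδ1
  refine ⟨hinj, fun lam hlam Λt => ?_⟩
  obtain ⟨y, hy⟩ := hΛ.exists_minimizer hc0 hM1 hlam Λt
  exact ⟨y, hy, fun y' hy' => minimizer_unique hinj hlam hy hy'⟩
end
end
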